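/- The set H ∩ C̄ is closed in V if and only if every connected component of Π* ∩ J₀ is of finite type. -/

import Mathlib

open Set Module

noncomputable section

/-- The linear reflection `x ↦ x - f x • a` associated to a vector `a` and a linear
functional `f` with `f a = 2`, bundled as a linear automorphism. -/
def reflEquiv {V : Type*} [AddCommGroup V] [Module ℝ V]
    (a : V) (f : V →ₗ[ℝ] ℝ) (h2 : f a = 2) : V ≃ₗ[ℝ] V :=
  LinearEquiv.ofInvolutive (LinearMap.id - f.smulRight a)
    (fun x => by
      simp only [LinearMap.sub_apply, LinearMap.id_apply, LinearMap.smulRight_apply,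
        map_sub, map_smul, smul_eq_mul, h2]
      module)

/-- A realization over `ℝ` of an `m × m` generalized Cartan matrix `A`:
simple roots `α_i`, simple coroots `α_i∨` (as linear functionals), with
`⟨α_j, α_i∨⟩ = a_{ij}`, together with the defining axioms. -/
structure GCMRealization (m : ℕ) (V : Type*) [NormedAddCommGroup V] [NormedSpace ℝ V] where
  A : Matrix (Fin m) (Fin m) ℤ
  root : Fin m → V
  coroot : Fin m → V →ₗ[ℝ] ℝ
  one_le_m : 1 ≤ m
  A_diag : ∀ i, A i i = 2
  A_offdiag : ∀ i j, i ≠ j → A i j ≤ 0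
  A_zero_iff : ∀ i j, A i j = 0 ↔ A j i = 0
  root_indep : LinearIndependent ℝ root
  coroot_indep : LinearIndependent ℝ coroot
  pairing : ∀ i j, coroot i (root j) = (A i j : ℝ)
  finDim : FiniteDimensional ℝ V
  dim_eq : finrank ℝ V + (A.map ((↑) : ℤ → ℝ)).rank = 2 * m

/-- A face of a convex set `H`: a convex subset `F ⊆ H` such that whenever the open
segment between two points of `H` meets `F`, both points lie in `F`. -/
def IsFaceOf {V : Type*} [NormedAddCommGroup V] [NormedSpace ℝ V] (H F : Set V) : Prop :=
  Convex ℝ F ∧ IsExtreme ℝ H F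

namespace GCMRealization

variable {m : ℕ} {V : Type*} [NormedAddCommGroup V] [NormedSpace ℝ V]
variable (S : GCMRealization m V)

/-- The fundamental reflection `r_i`. -/
def s (i : Fin m) : V ≃ₗ[ℝ] V :=
  reflEquiv (S.root i) (S.coroot i) (by
    have h := S.pairing i i
    rw [S.A_diag i] at h
    simpa using h)

/-- The Weyl group `W`, as a subgroup of the group of linear automorphisms of `V`. -/
def W : Subgroup (V ≃ₗ[ℝ] V) := Subgroup.closure (Set.range S.s)

/-- The standard parabolic subgroup `W_I` generated by the reflections indexed by `I`. -/
def WI (I : Set (Fin m)) : Subgroup (V ≃ₗ[ℝ] V) := Subgroup.closure (S.s '' I)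

/-- The closed fundamental chamber `C̄`. -/
def chamber : Set V := {η | ∀ i, 0 ≤ S.coroot i η}

/-- `J₀`: the set of indices `i` with `⟨μ, α_i∨⟩ = 0`. -/
def J0 (μ : V) : Set (Fin m) := {i | S.coroot i μ = 0}

/-- The orbit of `μ` under a subgroup of linear automorphisms. -/
def orbitOf (G : Subgroup (V ≃ₗ[ℝ] V)) (μ : V) : Set V :=
  (fun w : V ≃ₗ[ℝ] V => w μ) '' (G : Set (V ≃ₗ[ℝ] V))

/-- `F_I`: the convex hull of `W_I · μ`. -/
def face (μ : V) (I : Set (Fin m)) : Set V := convexHull ℝ (orbitOf (S.WI I) μ)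

/-- `H`: the convex hull of the Weyl group orbit of `μ`. -/
def orbitHull (μ : V) : Set V := convexHull ℝ (orbitOf S.W μ)

/-- `ℝ₊I`: the set of nonnegative linear combinations of the simple roots indexed by `I`. -/
def coneNonneg (I : Set (Fin m)) : Set V :=
  {v | ∃ c : Fin m → ℝ, (∀ i, 0 ≤ c i) ∧ (∀ i, i ∉ I → c i = 0) ∧ v = ∑ i, c i • S.root i}

/-- `ℝ_>I`: the set of strictly positive linear combinations of the simple roots indexed
by `I` (with `ℝ_>∅ = {0}`). -/
def conePos (I : Set (Fin m)) : Set V :=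
  {v | ∃ c : Fin m → ℝ, (∀ i ∈ I, 0 < c i) ∧ (∀ i, i ∉ I → c i = 0) ∧ v = ∑ i, c i • S.root i}

/-- The open standard facet `C_J`. -/
def openFacet (J : Set (Fin m)) : Set V :=
  {η | (∀ i ∈ J, S.coroot i η = 0) ∧ ∀ i, i ∉ J → 0 < S.coroot i η}

/-- The closed standard facet `C̄_J`. -/
def closedFacet (J : Set (Fin m)) : Set V :=
  {η | (∀ i ∈ J, S.coroot i η = 0) ∧ ∀ i, i ∉ J → 0 ≤ S.coroot i η}

/-- Adjacency of two vertices of the Dynkin diagram: `i ≠ j` and `a_{ij} ≠ 0`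
(equivalently `a_{ji} ≠ 0`). -/
def Adjacent (i j : Fin m) : Prop := i ≠ j ∧ S.A i j ≠ 0 ∧ S.A j i ≠ 0

/-- The Dynkin diagram, as a simple graph on the index set. -/
def diagram : SimpleGraph (Fin m) where
  Adj := S.Adjacent
  symm := ⟨fun _ _ h => ⟨h.1.symm, h.2.2, h.2.1⟩⟩
  loopless := ⟨fun _ h => h.1 rfl⟩

/-- A subset `I` is `μ`-connected if every connected component of `I` meets
`J_> = Π \ J₀` (the empty set is `μ`-connected). -/
def MuConnected (μ : V) (I : Set (Fin m)) : Prop :=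
  ∀ i : I, ∃ j : I, S.coroot (j : Fin m) μ ≠ 0 ∧ (S.diagram.induce I).Reachable i j

/-- The connected component of `i` inside `K`, as a subset of the index set. -/
def comp (K : Set (Fin m)) (i : Fin m) : Set (Fin m) :=
  {j | ∃ (hi : i ∈ K) (hj : j ∈ K), (S.diagram.induce K).Reachable ⟨i, hi⟩ ⟨j, hj⟩}

/-- `I*`: the largest `μ`-connected subset of `I`, i.e. the union of the connected
components of `I` that meet `J_>`. -/
def muPart (μ : V) (I : Set (Fin m)) : Set (Fin m) :=
  {j | ∃ (hj : j ∈ I) (k : Fin m) (hk : k ∈ I), S.coroot k μ ≠ 0 ∧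
    (S.diagram.induce I).Reachable ⟨j, hj⟩ ⟨k, hk⟩}

/-- `I_*`: the set of `α ∈ J₀ \ I` orthogonal to all of `I`. -/
def starSet (μ : V) (I : Set (Fin m)) : Set (Fin m) :=
  {i | S.coroot i μ = 0 ∧ i ∉ I ∧ ∀ j ∈ I, S.coroot i (S.root j) = 0}

/-- A subset `K ⊆ Π` is of finite type if the subgroup `W_K` is finite. -/
def FiniteType (K : Set (Fin m)) : Prop := ((S.WI K : Subgroup (V ≃ₗ[ℝ] V)) : Set (V ≃ₗ[ℝ] V)).Finite

/-- Every connected component of `K` is of finite type. -/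
def FinTypeComponents (K : Set (Fin m)) : Prop := ∀ i ∈ K, S.FiniteType (S.comp K i)

/-- A fundamental face of `H`: a face which is empty or whose relative interior meets
the fundamental chamber. -/
def IsFundFace (μ : V) (F : Set V) : Prop :=
  IsFaceOf (S.orbitHull μ) F ∧ (F = ∅ ∨ (intrinsicInterior ℝ F ∩ S.chamber).Nonempty)

/-- The length of `w ∈ W` with respect to the fundamental reflections. -/
def len (w : V ≃ₗ[ℝ] V) : ℕ :=
  sInf {k | ∃ l : List (Fin m), l.length = k ∧ w = (l.map S.s).prod}

end GCMRealization

end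


namespace GCMRealization

section helpers

set_option linter.unusedSimpArgs false
set_option linter.unnecessarySeqFocus false
set_option linter.unreachableTactic false
set_option linter.unusedTactic false

variable {m : ℕ} {V : Type*} [NormedAddCommGroup V] [NormedSpace ℝ V]
variable (S : GCMRealization m V)

theorem s_apply (i : Fin m) (v : V) : S.s i v = v - S.coroot i v • S.root i := by
  rfl

theorem coroot_root_self (i : Fin m) : S.coroot i (S.root i) = 2 := by
  rw [S.pairing, S.A_diag]; norm_num

theorem s_s (i : Fin m) (v : V) : S.s i (S.s i v) = v := by
  simp only [s_apply, map_sub, map_smul, S.coroot_root_self]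
  module

theorem s_mul_self (i : Fin m) : S.s i * S.s i = 1 := by
  ext v; simp [s_s]

/-- Linear combinations of simple roots. -/
def lc : (Fin m → ℝ) →ₗ[ℝ] V := Fintype.linearCombination ℝ S.root

theorem lc_apply (c : Fin m → ℝ) : S.lc c = ∑ i, c i • S.root i := rfl

theorem lc_inj : Function.Injective S.lc :=
  linearIndependent_iff_injective_fintypeLinearCombination.mp S.root_indep

theorem lc_single (i : Fin m) (t : ℝ) : S.lc (Pi.single i t) = t • S.root i := by
  simp [lc]

theorem coroot_lc (i : Fin m) (c : Fin m → ℝ) :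
    S.coroot i (S.lc c) = ∑ j, (S.A i j : ℝ) * c j := by
  simp [lc_apply, S.pairing, mul_comm]

theorem s_lc (i : Fin m) (c : Fin m → ℝ) :
    S.s i (S.lc c) = S.lc (c - Pi.single i (S.coroot i (S.lc c))) := by
  rw [s_apply, map_sub, lc_single]

/-- The product of a word in the fundamental reflections. -/
def prodW (l : List (Fin m)) : V ≃ₗ[ℝ] V := (l.map S.s).prod

theorem prodW_nil : S.prodW [] = 1 := rfl

theorem prodW_cons (i : Fin m) (l : List (Fin m)) : S.prodW (i :: l) = S.s i * S.prodW l := by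
  simp [prodW]

theorem prodW_append (l l' : List (Fin m)) : S.prodW (l ++ l') = S.prodW l * S.prodW l' := by
  simp [prodW]

theorem prodW_single (i : Fin m) : S.prodW [i] = S.s i := by
  simp [prodW]

theorem s_inv (i : Fin m) : (S.s i)⁻¹ = S.s i := by
  rw [inv_eq_iff_mul_eq_one, s_mul_self]

theorem prodW_reverse (l : List (Fin m)) : S.prodW l.reverse = (S.prodW l)⁻¹ := by
  induction l with
  | nil => simp [prodW]
  | cons i l ih =>
    rw [List.reverse_cons, prodW_append, ih, prodW_single, prodW_cons, mul_inv_rev, s_inv]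

theorem mem_WI_iff (K : Set (Fin m)) (w : V ≃ₗ[ℝ] V) :
    w ∈ S.WI K ↔ ∃ l : List (Fin m), (∀ i ∈ l, i ∈ K) ∧ w = S.prodW l := by
  constructor
  · intro h
    induction h using Subgroup.closure_induction with
    | mem x hx =>
      obtain ⟨i, hi, rfl⟩ := hx
      exact ⟨[i], by simpa using hi, (S.prodW_single i).symm⟩
    | one => exact ⟨[], by simp, rfl⟩
    | mul x y _ _ hx hy =>
      obtain ⟨l, hl, rfl⟩ := hx
      obtain ⟨l', hl', rfl⟩ := hy
      refine ⟨l ++ l', ?_, (S.prodW_append l l').symm⟩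
      intro i hi
      rcases List.mem_append.mp hi with h | h
      · exact hl i h
      · exact hl' i h
    | inv x _ hx =>
      obtain ⟨l, hl, rfl⟩ := hx
      exact ⟨l.reverse, by simpa using hl, (S.prodW_reverse l).symm⟩
  · rintro ⟨l, hl, rfl⟩
    induction l with
    | nil => exact Subgroup.one_mem _
    | cons i l ih =>
      rw [prodW_cons]
      refine Subgroup.mul_mem _ (Subgroup.subset_closure ⟨i, hl i (by simp), rfl⟩) (ih ?_)
      intro j hj
      exact hl j (by simp [hj])

theorem W_eq : S.W = S.WI Set.univ := by
  simp [W, WI, Set.image_univ]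

theorem WI_le (K : Set (Fin m)) : S.WI K ≤ S.W := by
  rw [W_eq]
  exact Subgroup.closure_mono (Set.image_mono (Set.subset_univ K))

theorem mem_W_iff (w : V ≃ₗ[ℝ] V) : w ∈ S.W ↔ ∃ l : List (Fin m), w = S.prodW l := by
  rw [W_eq, mem_WI_iff]; simp

theorem prodW_mem (l : List (Fin m)) : S.prodW l ∈ S.W := (S.mem_W_iff _).2 ⟨l, rfl⟩

theorem s_mem (i : Fin m) : S.s i ∈ S.W := Subgroup.subset_closure ⟨i, rfl⟩

theorem s_mem_WI {K : Set (Fin m)} {i : Fin m} (hi : i ∈ K) : S.s i ∈ S.WI K :=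
  Subgroup.subset_closure ⟨i, hi, rfl⟩

theorem len_le (l : List (Fin m)) : S.len (S.prodW l) ≤ l.length :=
  Nat.sInf_le ⟨l, rfl, rfl⟩

theorem exists_len {w : V ≃ₗ[ℝ] V} (hw : w ∈ S.W) :
    ∃ l : List (Fin m), l.length = S.len w ∧ w = S.prodW l := by
  obtain ⟨l, hl⟩ := (S.mem_W_iff w).1 hw
  exact Nat.sInf_mem (s := {k | ∃ l : List (Fin m), l.length = k ∧ w = (l.map S.s).prod})
    ⟨l.length, l, rfl, hl⟩

theorem len_mul_le {v : V ≃ₗ[ℝ] V} (hv : v ∈ S.W) (l : List (Fin m)) :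
    S.len (v * S.prodW l) ≤ S.len v + l.length := by
  obtain ⟨l', h1, h2⟩ := S.exists_len hv
  rw [← h1, ← List.length_append, h2, ← prodW_append]
  exact S.len_le _

/-- The nonnegative cone spanned by the simple roots. -/
def Pos (v : V) : Prop := ∃ c : Fin m → ℝ, (∀ i, 0 ≤ c i) ∧ v = S.lc c

theorem Pos.add {S : GCMRealization m V} {v w : V} (hv : S.Pos v) (hw : S.Pos w) :
    S.Pos (v + w) := by
  obtain ⟨c, hc, rfl⟩ := hv
  obtain ⟨d, hd, rfl⟩ := hw
  exact ⟨c + d, fun i => add_nonneg (hc i) (hd i), (map_add _ _ _).symm⟩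

theorem Pos.smul {S : GCMRealization m V} {v : V} (hv : S.Pos v) {t : ℝ} (ht : 0 ≤ t) :
    S.Pos (t • v) := by
  obtain ⟨c, hc, rfl⟩ := hv
  exact ⟨t • c, fun i => mul_nonneg ht (hc i), (map_smul _ _ _).symm⟩

theorem Pos.root (i : Fin m) : S.Pos (S.root i) := by
  refine ⟨Pi.single i 1, fun j => ?_, by rw [lc_single, one_smul]⟩
  by_cases h : j = i
  · subst h; simp
  · simp [h]

/-- Alternating words in `i, j`, ending in `j`. -/
def altW (i j : Fin m) : ℕ → List (Fin m)
  | 0 => []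
  | k + 1 => (if k % 2 = 0 then j else i) :: altW i j k

theorem altW_length (i j : Fin m) (k : ℕ) : (altW i j k).length = k := by
  induction k with
  | zero => rfl
  | succ k ih => simp [altW, ih]

theorem altW_split (i j : Fin m) (n k : ℕ) :
    ∃ p : List (Fin m), p.length = k ∧ altW i j (n + k) = p ++ altW i j n := by
  induction k with
  | zero => exact ⟨[], rfl, rfl⟩
  | succ k ih =>
    obtain ⟨p, hp, h⟩ := ih
    exact ⟨(if (n + k) % 2 = 0 then j else i) :: p, by simp [hp], by
      rw [← Nat.add_assoc, altW, h]; rfl⟩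

theorem A_adj_zero {i j : Fin m} : S.A i j = 0 ↔ S.A j i = 0 := S.A_zero_iff i j

theorem altW_last (i j : Fin m) (k : ℕ) :
    ∃ p : List (Fin m), p.length = k ∧ altW i j (k + 1) = p ++ [j] := by
  obtain ⟨p, hp, h⟩ := altW_split i j 1 k
  exact ⟨p, hp, by rw [Nat.add_comm, h]; simp [altW]⟩

theorem rank_two_braid (i j : Fin m) (n k : ℕ)
    (hbr : S.prodW (altW i j (n + 1)) = S.prodW (altW j i (n + 1))) (hk : n + 1 ≤ k) :
    ∃ l : List (Fin m), l.length < k ∧ S.prodW (altW i j k) * S.s i = S.prodW l := by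
  obtain ⟨d, rfl⟩ := Nat.exists_eq_add_of_le hk
  obtain ⟨p, hp, h⟩ := altW_split i j (n + 1) d
  obtain ⟨q, hq, h'⟩ := altW_last j i n
  refine ⟨p ++ q, by simp [hp, hq]; omega, ?_⟩
  rw [h, prodW_append, hbr, h', prodW_append, prodW_single, mul_assoc, mul_assoc,
    s_mul_self, mul_one, prodW_append]

/-- The dichotomy for dihedral subgroups. -/
theorem rank_two (i j : Fin m) (hij : i ≠ j) (k : ℕ) :
    (∃ x y : ℝ, 0 ≤ x ∧ 0 ≤ y ∧ S.prodW (altW i j k) (S.root i) = x • S.root i + y • S.root j) ∨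
    ∃ l : List (Fin m), l.length < k ∧ S.prodW (altW i j k) * S.s i = S.prodW l := by
  obtain ⟨a, ha⟩ : ∃ a, a = - S.A i j := ⟨_, rfl⟩
  obtain ⟨b, hb⟩ : ∃ b, b = - S.A j i := ⟨_, rfl⟩
  have ha0 : 0 ≤ a := by have := S.A_offdiag i j hij; omega
  have hb0 : 0 ≤ b := by have := S.A_offdiag j i hij.symm; omega
  have hab : a = 0 ↔ b = 0 := by have := S.A_zero_iff i j; omega
  have pij : S.coroot i (S.root j) = -(a : ℝ) := by rw [S.pairing, ha]; simp
  have pji : S.coroot j (S.root i) = -(b : ℝ) := by rw [S.pairing, hb]; simp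
  have pii := S.coroot_root_self i
  have pjj := S.coroot_root_self j
  by_cases h4 : 4 ≤ a * b
  · left
    have h4' : (4 : ℝ) ≤ a * b := by exact_mod_cast h4
    have ha0' : (0 : ℝ) ≤ a := by exact_mod_cast ha0
    have hb0' : (0 : ℝ) ≤ b := by exact_mod_cast hb0
    have key : ∃ x y : ℝ, 0 ≤ x ∧ 0 ≤ y ∧ (k % 2 = 0 → 2 * y ≤ b * x) ∧
        (k % 2 = 1 → 2 * x ≤ a * y) ∧
        S.prodW (altW i j k) (S.root i) = x • S.root i + y • S.root j := by
      induction k with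
      | zero => exact ⟨1, 0, by norm_num, le_rfl, by intro _; simpa using hb0', by simp,
          by simp [altW, prodW_nil]⟩
      | succ k ih =>
        obtain ⟨x, y, hx, hy, h0, h1, h⟩ := ih
        rcases Nat.mod_two_eq_zero_or_one k with hk | hk
        · have h0 := h0 hk
          refine ⟨x, b * x - y, hx, by nlinarith [mul_nonneg hb0' hx], by omega, ?_, ?_⟩
          · intro _
            nlinarith [mul_nonneg ha0' hx, mul_nonneg ha0' hy, mul_le_mul_of_nonneg_left h0 ha0',
              mul_le_mul_of_nonneg_right h4' hx]
          · rw [altW, if_pos hk, prodW_cons, LinearEquiv.mul_apply, h, s_apply]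
            simp only [map_add, map_smul, pji, pjj, smul_eq_mul]
            module
        · have h1 := h1 hk
          refine ⟨a * y - x, y, by nlinarith [mul_nonneg ha0' hy], hy, ?_, by omega, ?_⟩
          · intro _
            nlinarith [mul_nonneg hb0' hx, mul_nonneg hb0' hy, mul_le_mul_of_nonneg_left h1 hb0',
              mul_le_mul_of_nonneg_right h4' hy]
          · rw [altW, if_neg (by omega), prodW_cons, LinearEquiv.mul_apply, h, s_apply]
            simp only [map_add, map_smul, pij, pii, smul_eq_mul]
            module
    obtain ⟨x, y, hx, hy, -, -, h⟩ := key
    exact ⟨x, y, hx, hy, h⟩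
  · have hcases : (a = 0 ∧ b = 0) ∨ (a = 1 ∧ b = 1) ∨ (a = 1 ∧ b = 2) ∨ (a = 2 ∧ b = 1) ∨
        (a = 1 ∧ b = 3) ∨ (a = 3 ∧ b = 1) := by
      rcases eq_or_lt_of_le ha0 with h | h
      · exact Or.inl ⟨h.symm, hab.1 h.symm⟩
      have hbpos : 0 < b := by
        rcases eq_or_lt_of_le hb0 with h' | h'
        · have := hab.2 h'.symm; omega
        · exact h'
      have : a ≤ 3 := by nlinarith
      have : b ≤ 3 := by nlinarith
      clear pij pji pii pjj ha hb
      interval_cases a <;> interval_cases b <;> omega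
    clear h4 hab ha0 hb0 ha hb
    rcases hcases with ⟨rfl, rfl⟩ | ⟨rfl, rfl⟩ | ⟨rfl, rfl⟩ | ⟨rfl, rfl⟩ | ⟨rfl, rfl⟩ | ⟨rfl, rfl⟩
    · by_cases hk : k < 2
      · left
        interval_cases k
        · exact ⟨1, 0, by norm_num, by norm_num, by simp [altW, prodW, s_apply, pij, pji, pii, pjj] <;> module⟩
        · exact ⟨1, 0, by norm_num, by norm_num, by simp [altW, prodW, s_apply, pij, pji, pii, pjj] <;> module⟩
      · right
        refine S.rank_two_braid i j 1 k ?_ (by omega)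
        ext v
        simp [altW, prodW, s_apply, pij, pji, pii, pjj]
        module
    · by_cases hk : k < 3
      · left
        interval_cases k
        · exact ⟨1, 0, by norm_num, by norm_num, by simp [altW, prodW, s_apply, pij, pji, pii, pjj] <;> module⟩
        · exact ⟨1, 1, by norm_num, by norm_num, by simp [altW, prodW, s_apply, pij, pji, pii, pjj] <;> module⟩
        · exact ⟨0, 1, by norm_num, by norm_num, by simp [altW, prodW, s_apply, pij, pji, pii, pjj] <;> module⟩
      · right
        refine S.rank_two_braid i j 2 k ?_ (by omega)
        ext v
        simp [altW, prodW, s_apply, pij, pji, pii, pjj]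
        module
    · by_cases hk : k < 4
      · left
        interval_cases k
        · exact ⟨1, 0, by norm_num, by norm_num, by simp [altW, prodW, s_apply, pij, pji, pii, pjj] <;> module⟩
        · exact ⟨1, 2, by norm_num, by norm_num, by simp [altW, prodW, s_apply, pij, pji, pii, pjj] <;> module⟩
        · exact ⟨1, 2, by norm_num, by norm_num, by simp [altW, prodW, s_apply, pij, pji, pii, pjj] <;> module⟩
        · exact ⟨1, 0, by norm_num, by norm_num, by simp [altW, prodW, s_apply, pij, pji, pii, pjj] <;> module⟩
      · right
        refine S.rank_two_braid i j 3 k ?_ (by omega)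
        ext v
        simp [altW, prodW, s_apply, pij, pji, pii, pjj]
        module
    · by_cases hk : k < 4
      · left
        interval_cases k
        · exact ⟨1, 0, by norm_num, by norm_num, by simp [altW, prodW, s_apply, pij, pji, pii, pjj] <;> module⟩
        · exact ⟨1, 1, by norm_num, by norm_num, by simp [altW, prodW, s_apply, pij, pji, pii, pjj] <;> module⟩
        · exact ⟨1, 1, by norm_num, by norm_num, by simp [altW, prodW, s_apply, pij, pji, pii, pjj] <;> module⟩
        · exact ⟨1, 0, by norm_num, by norm_num, by simp [altW, prodW, s_apply, pij, pji, pii, pjj] <;> module⟩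
      · right
        refine S.rank_two_braid i j 3 k ?_ (by omega)
        ext v
        simp [altW, prodW, s_apply, pij, pji, pii, pjj]
        module
    · by_cases hk : k < 6
      · left
        interval_cases k
        · exact ⟨1, 0, by norm_num, by norm_num, by simp [altW, prodW, s_apply, pij, pji, pii, pjj] <;> module⟩
        · exact ⟨1, 3, by norm_num, by norm_num, by simp [altW, prodW, s_apply, pij, pji, pii, pjj] <;> module⟩
        · exact ⟨2, 3, by norm_num, by norm_num, by simp [altW, prodW, s_apply, pij, pji, pii, pjj] <;> module⟩
        · exact ⟨2, 3, by norm_num, by norm_num, by simp [altW, prodW, s_apply, pij, pji, pii, pjj] <;> module⟩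
        · exact ⟨1, 3, by norm_num, by norm_num, by simp [altW, prodW, s_apply, pij, pji, pii, pjj] <;> module⟩
        · exact ⟨1, 0, by norm_num, by norm_num, by simp [altW, prodW, s_apply, pij, pji, pii, pjj] <;> module⟩
      · right
        refine S.rank_two_braid i j 5 k ?_ (by omega)
        ext v
        simp [altW, prodW, s_apply, pij, pji, pii, pjj]
        module
    · by_cases hk : k < 6
      · left
        interval_cases k
        · exact ⟨1, 0, by norm_num, by norm_num, by simp [altW, prodW, s_apply, pij, pji, pii, pjj] <;> module⟩
        · exact ⟨1, 1, by norm_num, by norm_num, by simp [altW, prodW, s_apply, pij, pji, pii, pjj] <;> module⟩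
        · exact ⟨2, 1, by norm_num, by norm_num, by simp [altW, prodW, s_apply, pij, pji, pii, pjj] <;> module⟩
        · exact ⟨2, 1, by norm_num, by norm_num, by simp [altW, prodW, s_apply, pij, pji, pii, pjj] <;> module⟩
        · exact ⟨1, 1, by norm_num, by norm_num, by simp [altW, prodW, s_apply, pij, pji, pii, pjj] <;> module⟩
        · exact ⟨1, 0, by norm_num, by norm_num, by simp [altW, prodW, s_apply, pij, pji, pii, pjj] <;> module⟩
      · right
        refine S.rank_two_braid i j 5 k ?_ (by omega)
        ext v
        simp [altW, prodW, s_apply, pij, pji, pii, pjj]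
        module

end helpers

end GCMRealization

namespace GCMRealization

section helpers2

variable {m : ℕ} {V : Type*} [NormedAddCommGroup V] [NormedSpace ℝ V]
variable (S : GCMRealization m V)

/-- A nontrivial element has a decomposition `w = v * s j` with `len v + 1 = len w`. -/
theorem exists_last {w : V ≃ₗ[ℝ] V} (hw : w ∈ S.W) (h0 : S.len w ≠ 0) :
    ∃ v ∈ S.W, ∃ j, w = v * S.s j ∧ S.len v + 1 = S.len w := by
  obtain ⟨l, hl, rfl⟩ := S.exists_len hw
  rcases List.eq_nil_or_concat l with rfl | ⟨l', j, rfl⟩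
  · simp at hl; omega
  · refine ⟨S.prodW l', S.prodW_mem l', j, ?_, ?_⟩
    · rw [List.concat_eq_append, prodW_append, prodW_single]
    · have h1 := S.len_le l'
      have h2 := S.len_mul_le (S.prodW_mem l') [j]
      rw [List.concat_eq_append, prodW_append] at *
      simp at hl h2
      omega

theorem eq_one_of_len {w : V ≃ₗ[ℝ] V} (hw : w ∈ S.W) (h0 : S.len w = 0) : w = 1 := by
  obtain ⟨l, hl, rfl⟩ := S.exists_len hw
  rw [h0, List.length_eq_zero_iff] at hl
  rw [hl]; rfl

/-- The lemma of Tits. -/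
theorem tits (n : ℕ) : ∀ w ∈ S.W, S.len w = n → ∀ i, S.len w ≤ S.len (w * S.s i) →
    S.Pos (w (S.root i)) := by
  induction n using Nat.strong_induction_on with
  | _ n ih =>
  intro w hw hn i hi
  by_cases h0 : S.len w = 0
  · rw [S.eq_one_of_len hw h0]; exact Pos.root S i
  obtain ⟨v0, hv0, j, hwj, hlen⟩ := S.exists_last hw h0
  have hij : i ≠ j := by
    rintro rfl
    have : w * S.s i = v0 := by rw [hwj, mul_assoc, s_mul_self, mul_one]
    rw [this] at hi
    omega
  obtain ⟨k, ⟨v, hv, hwv, hvk⟩, hmax⟩ : ∃ k,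
      (∃ v ∈ S.W, w = v * S.prodW (altW i j (k + 1)) ∧ S.len v + (k + 1) = S.len w) ∧
      ¬ (∃ v ∈ S.W, w = v * S.prodW (altW i j (k + 1 + 1)) ∧ S.len v + (k + 1 + 1) = S.len w) := by
    by_contra hcon
    push Not at hcon
    have : ∀ k, ∃ v ∈ S.W, w = v * S.prodW (altW i j (k + 1)) ∧ S.len v + (k + 1) = S.len w := by
      intro k
      induction k with
      | zero => exact ⟨v0, hv0, by simpa [altW, prodW_single] using hwj, hlen⟩
      | succ k ihk =>
        obtain ⟨v, h1, h2, h3⟩ := hcon k ihk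
        exact ⟨v, h1, h2, h3⟩
    obtain ⟨v, -, -, h⟩ := this (S.len w)
    omega
  have hg : S.len v ≤ S.len (v * S.s (if (k + 1) % 2 = 0 then j else i)) := by
    by_contra hlt
    push Not at hlt
    have hmem := S.W.mul_mem hv (S.s_mem (if (k + 1) % 2 = 0 then j else i))
    have heq : w = (v * S.s (if (k + 1) % 2 = 0 then j else i)) *
        S.prodW (altW i j (k + 1 + 1)) := by
      rw [altW, prodW_cons, mul_assoc, ← mul_assoc (S.s _) (S.s _), s_mul_self, one_mul, hwv]
    refine hmax ⟨_, hmem, heq, ?_⟩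
    have := S.len_mul_le hmem (altW i j (k + 1 + 1))
    rw [← heq, altW_length] at this
    omega
  have hf : S.len v ≤ S.len (v * S.s (if k % 2 = 0 then j else i)) := by
    by_contra hlt
    push Not at hlt
    have hmem := S.W.mul_mem hv (S.s_mem (if k % 2 = 0 then j else i))
    have heq : w = (v * S.s (if k % 2 = 0 then j else i)) * S.prodW (altW i j k) := by
      rw [hwv, altW, prodW_cons, mul_assoc]
    have := S.len_mul_le hmem (altW i j k)
    rw [← heq, altW_length] at this
    omega
  have hvi : S.len v ≤ S.len (v * S.s i) ∧ S.len v ≤ S.len (v * S.s j) := by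
    rcases Nat.mod_two_eq_zero_or_one k with h | h
    · rw [if_pos h] at hf
      rw [if_neg (by omega)] at hg
      exact ⟨hg, hf⟩
    · rw [if_neg (by omega)] at hf
      rw [if_pos (by omega)] at hg
      exact ⟨hf, hg⟩
  have pi := ih (S.len v) (by omega) v hv rfl i hvi.1
  have pj := ih (S.len v) (by omega) v hv rfl j hvi.2
  rcases S.rank_two i j hij (k + 1) with ⟨x, y, hx, hy, h⟩ | ⟨l, hl, h⟩
  · rw [hwv, LinearEquiv.mul_apply, h, map_add, map_smul, map_smul]
    exact (pi.smul hx).add (pj.smul hy)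
  · exfalso
    have h1 := S.len_mul_le hv l
    rw [← h, ← mul_assoc, ← hwv] at h1
    omega

@[elab_as_elim]
theorem red_induct {P : (V ≃ₗ[ℝ] V) → Prop} (h1 : P 1)
    (hs : ∀ v ∈ S.W, ∀ i, S.Pos (v (S.root i)) → P v → P (v * S.s i))
    (w : V ≃ₗ[ℝ] V) (hw : w ∈ S.W) : P w := by
  revert w
  have : ∀ n, ∀ w ∈ S.W, S.len w = n → P w := by
    intro n
    induction n with
    | zero => intro w hw h; rw [S.eq_one_of_len hw h]; exact h1
    | succ n ih =>
      intro w hw h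
      obtain ⟨v, hv, j, rfl, hlen⟩ := S.exists_last hw (by omega)
      exact hs v hv j (S.tits _ v hv rfl j (by omega)) (ih v hv (by omega))
  exact fun w hw => this _ w hw rfl

@[elab_as_elim]
theorem word_induct {K : Set (Fin m)} {P : (V ≃ₗ[ℝ] V) → Prop} (h1 : P 1)
    (hs : ∀ v ∈ S.WI K, ∀ i ∈ K, P v → P (S.s i * v))
    (w : V ≃ₗ[ℝ] V) (hw : w ∈ S.WI K) : P w := by
  obtain ⟨l, hl, rfl⟩ := (S.mem_WI_iff K w).1 hw
  clear hw
  induction l with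
  | nil => exact h1
  | cons i l ih =>
    rw [prodW_cons]
    have hl' : ∀ j ∈ l, j ∈ K := fun j hj => hl j (by simp [hj])
    exact hs _ ((S.mem_WI_iff K _).2 ⟨l, hl', rfl⟩) i (hl i (by simp)) (ih hl')

theorem supp_WI {K : Set (Fin m)} {w : V ≃ₗ[ℝ] V} (hw : w ∈ S.WI K) (v : V) :
    ∃ c : Fin m → ℝ, (∀ i, i ∉ K → c i = 0) ∧ w v = v - S.lc c := by
  refine S.word_induct ?_ ?_ w hw
  · exact ⟨0, by simp, by simp⟩
  rintro w hw i hi ⟨c, hc, h⟩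
  refine ⟨c + Pi.single i (S.coroot i (w v)), ?_, ?_⟩
  · intro j hj
    have : j ≠ i := by rintro rfl; exact hj hi
    simp [hc j hj, this]
  · rw [LinearEquiv.mul_apply, s_apply, map_add, lc_single, ← sub_sub, ← h]

theorem pos_sub_J0 {μ : V} (hμ : μ ∈ S.chamber) {w : V ≃ₗ[ℝ] V} (hw : w ∈ S.W) :
    ∃ c : Fin m → ℝ, (∀ i, 0 ≤ c i) ∧ w μ = μ - S.lc c ∧
      (w ∈ S.WI (S.J0 μ) ∨ ∃ j, S.coroot j μ ≠ 0 ∧ 0 < c j) := by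
  refine S.red_induct ?_ ?_ w hw
  · exact ⟨0, by simp, by simp, Or.inl (Subgroup.one_mem _)⟩
  rintro v hv i ⟨d, hd, hvd⟩ ⟨c, hc, h, h'⟩
  refine ⟨c + S.coroot i μ • d, fun j => add_nonneg (hc j) (mul_nonneg (hμ i) (hd j)), ?_, ?_⟩
  · rw [LinearEquiv.mul_apply, s_apply, map_sub, map_smul, h, hvd, map_add, map_smul, sub_sub]
  · rcases h' with h' | ⟨j, hj, hcj⟩
    · by_cases hi : S.coroot i μ = 0
      · exact Or.inl (Subgroup.mul_mem _ h' (S.s_mem_WI hi))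
      · right
        refine ⟨i, hi, ?_⟩
        obtain ⟨e, he, hve⟩ := S.supp_WI h' (S.root i)
        have : d = Pi.single i 1 - e := by
          apply S.lc_inj
          rw [← hvd, hve, map_sub, lc_single, one_smul]
        have hdi : d i = 1 := by
          rw [this]; simp [he i hi]
        simp only [Pi.add_apply, Pi.smul_apply, hdi, smul_eq_mul, mul_one]
        have := lt_of_le_of_ne (hμ i) (Ne.symm hi)
        have := hc i
        linarith
    · exact Or.inr ⟨j, hj, add_pos_of_pos_of_nonneg hcj (mul_nonneg (hμ i) (hd j))⟩

theorem WI_J0_fix {μ : V} {w : V ≃ₗ[ℝ] V} (hw : w ∈ S.WI (S.J0 μ)) : w μ = μ := by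
  refine S.word_induct ?_ ?_ w hw
  · exact rfl
  intro v _ i hi h
  rw [LinearEquiv.mul_apply, h, s_apply, show S.coroot i μ = 0 from hi]; simp

theorem exists_rho : ∃ x : V, ∀ i, S.coroot i x = 1 := by
  have := S.finDim
  have hs : Function.Surjective (LinearMap.pi S.coroot) := by
    rw [← LinearMap.range_eq_top]
    by_contra hne
    obtain ⟨f, hf, hf'⟩ := Submodule.exists_le_ker_of_lt_top _ (lt_top_iff_ne_top.2 hne)
    apply hf
    have hind := Fintype.linearIndependent_iff.1 S.coroot_indep (fun i => f (Pi.single i 1)) (by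
      ext v
      have h1 : f (LinearMap.pi S.coroot v) = 0 := hf' ⟨v, rfl⟩
      rw [LinearMap.pi_apply_eq_sum_univ f] at h1
      have hPi : ∀ i : Fin m, (fun j => if i = j then (1:ℝ) else 0) = Pi.single i 1 := by
        intro i; ext j; simp [Pi.single_apply, eq_comm]
      simpa [hPi, mul_comm] using h1)
    ext i
    simpa using hind i
  obtain ⟨x, hx⟩ := hs (fun _ => 1)
  exact ⟨x, fun i => congrFun hx i⟩

theorem rho_free {x : V} (hx : ∀ i, S.coroot i x = 1) {w : V ≃ₗ[ℝ] V} (hw : w ∈ S.W)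
    (hwx : w x = x) : w = 1 := by
  have : w = 1 ∨ ∃ c : Fin m → ℝ, (∀ i, 0 ≤ c i) ∧ c ≠ 0 ∧ w x = x - S.lc c := by
    clear hwx
    refine S.red_induct ?_ ?_ w hw
    · exact (Or.inl rfl)
    rintro v hv i ⟨d, hd, hvd⟩ h
    right
    have hd0 : d ≠ 0 := by
      rintro rfl
      rw [map_zero] at hvd
      exact S.root_indep.ne_zero i (by simpa using hvd)
    have hvs : (v * S.s i) x = v x - S.lc d := by
      rw [LinearEquiv.mul_apply, s_apply, hx, one_smul, map_sub, hvd]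
    rcases h with rfl | ⟨c, hc, hc0, h⟩
    · exact ⟨d, hd, hd0, hvs⟩
    · refine ⟨c + d, fun j => add_nonneg (hc j) (hd j), ?_, ?_⟩
      · intro h0
        apply hc0
        ext j
        have := congrFun h0 j
        simp at this
        have := hc j
        have := hd j
        simp; linarith
      · rw [hvs, h, map_add, sub_sub]
  rcases this with h | ⟨c, hc, hc0, h⟩
  · exact h
  · exfalso
    apply hc0
    apply S.lc_inj
    rw [map_zero]
    rw [hwx] at h
    simpa using h.symm

theorem coroot_lc_int (i : Fin m) (z : Fin m → ℤ) :
    ∃ n : ℤ, S.coroot i (S.lc fun j => (z j : ℝ)) = n := by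
  refine ⟨∑ j, S.A i j * z j, ?_⟩
  rw [coroot_lc]; push_cast; rfl

theorem rho_int {x : V} (hx : ∀ i, S.coroot i x = 1) {w : V ≃ₗ[ℝ] V} (hw : w ∈ S.W) :
    ∃ z : Fin m → ℤ, w x = x - S.lc (fun j => (z j : ℝ)) := by
  rw [W_eq] at hw
  refine S.word_induct ?_ ?_ w hw
  · refine ⟨0, ?_⟩
    have : (fun j : Fin m => (((0 : Fin m → ℤ) j : ℤ) : ℝ)) = 0 := by ext; simp
    rw [this]; simp
  · rintro v - i - ⟨z, h⟩
    obtain ⟨n, hn⟩ := S.coroot_lc_int i z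
    refine ⟨z + Pi.single i (1 - n), ?_⟩
    have : (fun j : Fin m => (((z + Pi.single i (1 - n) : Fin m → ℤ) j : ℤ) : ℝ)) =
        (fun j => (z j : ℝ)) + Pi.single i (1 - n : ℝ) := by
      ext j
      by_cases hj : j = i
      · subst hj; simp
      · simp [hj]
    rw [this, LinearEquiv.mul_apply, s_apply, h, map_sub, hx, hn, map_add, lc_single, sub_sub]

theorem coroot_nonpos {c : Fin m → ℝ} (hc : ∀ j, 0 ≤ c j) {i : Fin m} (hi : c i = 0) :
    S.coroot i (S.lc c) ≤ 0 := by
  rw [coroot_lc]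
  refine Finset.sum_nonpos fun j _ => ?_
  by_cases h : i = j
  · subst h; simp [hi]
  · have : (S.A i j : ℝ) ≤ 0 := by exact_mod_cast S.A_offdiag i j h
    exact mul_nonpos_of_nonpos_of_nonneg this (hc j)

theorem coroot_zero_nbr {c : Fin m → ℝ} (hc : ∀ j, 0 ≤ c j) {i : Fin m} (hi : c i = 0)
    (h0 : 0 ≤ S.coroot i (S.lc c)) {j : Fin m} (hj : S.A i j ≠ 0) : c j = 0 := by
  have hterm : ∀ j ∈ Finset.univ, (S.A i j : ℝ) * c j ≤ 0 := by
    intro j _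
    by_cases h : i = j
    · subst h; simp [hi]
    · have : (S.A i j : ℝ) ≤ 0 := by exact_mod_cast S.A_offdiag i j h
      exact mul_nonpos_of_nonpos_of_nonneg this (hc j)
  have hz : ∑ j, (S.A i j : ℝ) * c j = 0 :=
    le_antisymm (Finset.sum_nonpos hterm) (by rwa [coroot_lc] at h0)
  have := (Finset.sum_eq_zero_iff_of_nonpos hterm).1 hz j (Finset.mem_univ j)
  rcases mul_eq_zero.1 this with h | h
  · exact absurd (by exact_mod_cast h) hj
  · exact h

/-- The sum over a finite parabolic subgroup is fixed. -/
theorem avg_fixed {K : Set (Fin m)} [Fintype (S.WI K)] {i : Fin m} (hi : i ∈ K) (v : V) :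
    S.coroot i (∑ g : S.WI K, (g : V ≃ₗ[ℝ] V) v) = 0 := by
  have h : S.s i (∑ g : S.WI K, (g : V ≃ₗ[ℝ] V) v) = ∑ g : S.WI K, (g : V ≃ₗ[ℝ] V) v := by
    rw [map_sum]
    exact Fintype.sum_equiv (Equiv.mulLeft (⟨S.s i, S.s_mem_WI hi⟩ : S.WI K)) _ _ (fun g => rfl)
  rw [s_apply, sub_eq_self, smul_eq_zero] at h
  exact h.resolve_right (S.root_indep.ne_zero i)

theorem fin_u {K : Set (Fin m)} (hK : S.FiniteType K) :
    ∃ u : Fin m → ℝ, (∀ i, 0 ≤ u i) ∧ (∀ i, i ∉ K → u i = 0) ∧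
      (∀ i ∈ K, 0 < u i) ∧ ∀ i ∈ K, 0 < S.coroot i (S.lc u) := by
  have : Finite (S.WI K) := hK
  have := Fintype.ofFinite (S.WI K)
  obtain ⟨x, hx⟩ := S.exists_rho
  have hxc : x ∈ S.chamber := fun i => by rw [hx]; exact zero_le_one
  have h1 : ∀ g : S.WI K, ∃ c : Fin m → ℝ, (∀ i, 0 ≤ c i) ∧ (∀ i, i ∉ K → c i = 0) ∧
      (g : V ≃ₗ[ℝ] V) x = x - S.lc c := by
    intro g
    obtain ⟨c, hc, h, -⟩ := S.pos_sub_J0 hxc (S.WI_le K g.2)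
    obtain ⟨d, hd, h'⟩ := S.supp_WI g.2 x
    have : c = d := by
      apply S.lc_inj
      rw [h] at h'
      simpa using h'
    exact ⟨c, hc, this ▸ hd, h⟩
  choose c hc hcK hcx using h1
  have hpos : ∀ i ∈ K, 0 < S.coroot i (S.lc (∑ g, c g)) := by
    intro i hi
    have h := S.avg_fixed hi x
    simp only [hcx, Finset.sum_sub_distrib, map_sub] at h
    rw [map_sum S.lc]
    simp only [Finset.sum_const, map_nsmul, hx] at h
    have hcard : 0 < Fintype.card (S.WI K) := Fintype.card_pos
    have : (0 : ℝ) < (Finset.univ : Finset (S.WI K)).card := by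
      rw [Finset.card_univ]; exact_mod_cast hcard
    simp only [nsmul_eq_mul, mul_one] at h
    linarith
  have hnn : ∀ i, 0 ≤ (∑ g, c g) i := fun i => by
    rw [Finset.sum_apply]; exact Finset.sum_nonneg fun g _ => hc g i
  refine ⟨∑ g, c g, hnn, fun i hi => ?_, fun i hi => ?_, hpos⟩
  · rw [Finset.sum_apply]; exact Finset.sum_eq_zero fun g _ => hcK g i hi
  · refine lt_of_le_of_ne (hnn i) fun h => ?_
    exact absurd (S.coroot_nonpos hnn h.symm) (not_le.2 (hpos i hi))

theorem fin_nonpos {K : Set (Fin m)} (hK : S.FiniteType K) {p : Fin m → ℝ}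
    (hp : ∀ i, i ∉ K → p i = 0) (hle : ∀ i ∈ K, S.coroot i (S.lc p) ≤ 0) (i : Fin m) :
    p i ≤ 0 := by
  classical
  obtain ⟨u, hu0, huK, hu, hAu⟩ := S.fin_u hK
  by_contra hi
  push Not at hi
  have hiK : i ∈ K := by by_contra h; rw [hp i h] at hi; exact lt_irrefl _ hi
  obtain ⟨k, hk, hmax⟩ := Finset.exists_max_image (Finset.univ.filter (· ∈ K))
    (fun j => p j / u j) ⟨i, by simp [hiK]⟩
  simp only [Finset.mem_filter, Finset.mem_univ, true_and] at hk hmax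
  have ht : 0 < p k / u k := lt_of_lt_of_le (div_pos hi (hu i hiK)) (hmax i hiK)
  have hq : ∀ j, 0 ≤ ((p k / u k) • u - p) j := by
    intro j
    by_cases hj : j ∈ K
    · have := hmax j hj
      rw [div_le_iff₀ (hu j hj)] at this
      simpa using this
    · simp [huK j hj, hp j hj]
  have hqk : ((p k / u k) • u - p) k = 0 := by
    simp [div_mul_cancel₀ _ (hu k hk).ne']
  have h1 := S.coroot_nonpos hq hqk
  rw [map_sub, map_smul, map_sub, map_smul, smul_eq_mul] at h1
  have h2 := mul_pos ht (hAu k hk)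
  have h3 := hle k hk
  linarith

/-- Combinatorial form of `μ`-connectedness. -/
def MC (μ : V) (I : Set (Fin m)) : Prop :=
  ∀ R ⊆ I, R.Nonempty → (∀ i ∈ R, S.coroot i μ = 0) → ∃ i ∈ R, ∃ j ∈ I, j ∉ R ∧ S.A i j ≠ 0

theorem mc_lemma {μ : V} (hμ : μ ∈ S.chamber) {I : Set (Fin m)} (hI : S.MC μ I)
    {g p : Fin m → ℝ} (hg : ∀ i, 0 ≤ g i) (hp : ∀ i, 0 ≤ p i)
    (hgI : ∀ i, i ∉ I → g i = 0) (hpI : ∀ i, i ∉ I → p i = 0)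
    (hgp : ∀ i ∈ I, 0 < g i + p i)
    (h1 : ∀ i, p i ≠ 0 → S.coroot i μ ≤ S.coroot i (S.lc g))
    (h2 : ∀ i, p i ≠ 0 → S.coroot i (S.lc p) ≤ 0) : p = 0 := by
  classical
  have hgpos : ∀ i ∈ I, 0 < g i := by
    by_contra hcon
    push Not at hcon
    obtain ⟨i, hi, hgi⟩ := hcon
    have key : ∀ i ∈ {i ∈ I | g i = 0}, S.coroot i μ = 0 ∧ ∀ j, S.A i j ≠ 0 → g j = 0 := by
      rintro i ⟨hi, h0⟩
      have hpi : p i ≠ 0 := by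
        have := hgp i hi
        rw [h0, zero_add] at this
        exact this.ne'
      have a1 := h1 i hpi
      have a2 := S.coroot_nonpos hg h0
      have a3 := hμ i
      exact ⟨by linarith, fun j hj => S.coroot_zero_nbr hg h0 (by linarith) hj⟩
    obtain ⟨i', hi', j, hj, hjR, hA⟩ := hI {i ∈ I | g i = 0} (fun i hi => hi.1)
      ⟨i, hi, le_antisymm hgi (hg i)⟩ (fun i hi => (key i hi).1)
    exact hjR ⟨hj, (key i' hi').2 j hA⟩
  by_contra hp0
  obtain ⟨i, hi⟩ : ∃ i, p i ≠ 0 := by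
    by_contra h
    push Not at h
    exact hp0 (funext h)
  have hiI : i ∈ I := by by_contra h; exact hi (hpI i h)
  obtain ⟨k, hk, hmax⟩ := Finset.exists_max_image (Finset.univ.filter (· ∈ I))
    (fun j => p j / g j) ⟨i, by simp [hiI]⟩
  simp only [Finset.mem_filter, Finset.mem_univ, true_and] at hk hmax
  have ht : 0 < p k / g k := lt_of_lt_of_le
    (div_pos (lt_of_le_of_ne (hp i) (Ne.symm hi)) (hgpos i hiI)) (hmax i hiI)
  obtain ⟨t, htdef⟩ : ∃ t, t = p k / g k := ⟨_, rfl⟩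
  rw [← htdef] at ht hmax
  have hq : ∀ j, 0 ≤ (t • g - p) j := by
    intro j
    by_cases hj : j ∈ I
    · have := hmax j hj
      rw [div_le_iff₀ (hgpos j hj)] at this
      simpa using this
    · simp [hgI j hj, hpI j hj]
  have key : ∀ i ∈ {i ∈ I | (t • g - p) i = 0}, S.coroot i μ = 0 ∧
      ∀ j, S.A i j ≠ 0 → (t • g - p) j = 0 := by
    rintro i ⟨hi, h0⟩
    have hpi : p i ≠ 0 := by
      have h3 : p i = t * g i := by simp at h0; linarith
      rw [h3]; exact (mul_pos ht (hgpos i hi)).ne'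
    have a1 := h1 i hpi
    have a2 := S.coroot_nonpos hq h0
    have a3 := hμ i
    have a4 := h2 i hpi
    have a5 : S.coroot i (S.lc (t • g - p)) = t * S.coroot i (S.lc g) - S.coroot i (S.lc p) := by
      rw [map_sub, map_smul, map_sub, map_smul, smul_eq_mul]
    have a6 := mul_le_mul_of_nonneg_left a1 ht.le
    have a7 := mul_nonneg ht.le a3
    refine ⟨?_, fun j hj => S.coroot_zero_nbr hq h0 (by linarith) hj⟩
    have a8 : t * S.coroot i μ = 0 := by linarith
    exact (mul_eq_zero.1 a8).resolve_left ht.ne'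
  obtain ⟨i', hi', j, hj, hjR, hA⟩ := hI {i ∈ I | (t • g - p) i = 0} (fun i hi => hi.1)
    ⟨k, hk, by simp [htdef, div_mul_cancel₀ _ (hgpos k hk).ne']⟩ (fun i hi => (key i hi).1)
  exact hjR ⟨hj, (key i' hi').2 j hA⟩

end helpers2

end GCMRealization

namespace GCMRealization

section helpers3

variable {m : ℕ} {V : Type*} [NormedAddCommGroup V] [NormedSpace ℝ V]
variable (S : GCMRealization m V)

theorem exists_T {w : V ≃ₗ[ℝ] V} (hw : w ∈ S.W) :
    ∃ T : (Fin m → ℝ) →ₗ[ℝ] (Fin m → ℝ), ∀ c, w (S.lc c) = S.lc (T c) := by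
  rw [W_eq] at hw
  refine S.word_induct ?_ ?_ w hw
  · exact ⟨LinearMap.id, fun c => rfl⟩
  · rintro v - i - ⟨T, hT⟩
    refine ⟨T - (LinearMap.single ℝ (fun _ => ℝ) i) ∘ₗ S.coroot i ∘ₗ S.lc ∘ₗ T, fun c => ?_⟩
    rw [LinearEquiv.mul_apply, hT, s_lc]
    rfl

theorem pos_lc {c : Fin m → ℝ} : S.Pos (S.lc c) ↔ ∀ i, 0 ≤ c i := by
  constructor
  · rintro ⟨d, hd, h⟩
    rw [S.lc_inj h]; exact hd
  · intro h; exact ⟨c, h, rfl⟩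

theorem infinite_cone_ne {K : Set (Fin m)} (hK : ¬ S.FiniteType K) :
    ∃ c : Fin m → ℝ, c ≠ 0 ∧ (∀ i, i ∉ K → c i = 0) ∧ ∀ w ∈ S.WI K, S.Pos (w (S.lc c)) := by
  obtain ⟨x, hx⟩ := S.exists_rho
  have hxc : x ∈ S.chamber := fun i => by rw [hx]; exact zero_le_one
  have h1 : ∀ g : S.WI K, ∃ z : Fin m → ℤ, (∀ i, 0 ≤ z i) ∧ (∀ i, i ∉ K → z i = 0) ∧
      (g : V ≃ₗ[ℝ] V) x = x - S.lc (fun i => (z i : ℝ)) := by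
    intro g
    obtain ⟨c, hc, h, -⟩ := S.pos_sub_J0 hxc (S.WI_le K g.2)
    obtain ⟨d, hd, h'⟩ := S.supp_WI g.2 x
    obtain ⟨z, hz⟩ := S.rho_int hx (S.WI_le K g.2)
    have e1 : c = fun i => (z i : ℝ) := by
      apply S.lc_inj; rw [h] at hz; simpa using hz
    have e2 : d = fun i => (z i : ℝ) := by
      apply S.lc_inj; rw [h'] at hz; simpa using hz
    refine ⟨z, fun i => ?_, fun i hi => ?_, hz⟩
    · have := hc i
      rw [e1] at this
      have h9 : (0:ℝ) ≤ (z i : ℝ) := this; exact_mod_cast h9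
    · have := hd i hi
      rw [e2] at this
      have h9 : (z i : ℝ) = 0 := this; exact_mod_cast h9
  choose z hz hzK hzx using h1
  have hinj : Function.Injective z := by
    intro g g' h
    have h2 : (g : V ≃ₗ[ℝ] V) x = (g' : V ≃ₗ[ℝ] V) x := by rw [hzx, hzx, h]
    have h3 : ((g' : V ≃ₗ[ℝ] V)⁻¹ * g) x = x := by
      rw [LinearEquiv.mul_apply, h2, ← LinearEquiv.mul_apply, inv_mul_cancel]; rfl
    have h4 := S.rho_free hx (S.W.mul_mem (S.W.inv_mem (S.WI_le K g'.2)) (S.WI_le K g.2)) h3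
    exact Subtype.ext (inv_mul_eq_one.1 h4).symm
  have hunb : ∀ n : ℕ, ∃ g, (n : ℝ) < ∑ i, (z g i : ℝ) := by
    intro n
    by_contra hcon
    push Not at hcon
    apply hK
    have hsub : Set.range z ⊆ Set.Icc 0 (fun _ => (n : ℤ)) := by
      rintro _ ⟨g, rfl⟩
      refine ⟨fun i => hz g i, fun i => ?_⟩
      have h5 : (z g i : ℝ) ≤ n := le_trans (Finset.single_le_sum (f := fun i => (z g i : ℝ))
        (fun j _ => by exact_mod_cast hz g j) (Finset.mem_univ i)) (hcon g)
      exact_mod_cast h5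
    have hfin : (Set.range z).Finite := (Set.finite_Icc _ _).subset hsub
    have : Finite (S.WI K) := by
      have := hfin.to_subtype
      exact Finite.of_injective (Set.rangeFactorization z)
        (fun a b h => hinj (congrArg Subtype.val h))
    exact this
  choose g hg using hunb
  have hpos : ∀ n, 0 < ∑ i, (z (g n) i : ℝ) := fun n => lt_of_le_of_lt (Nat.cast_nonneg n) (hg n)
  let γ : ℕ → (Fin m → ℝ) := fun n => (∑ i, (z (g n) i : ℝ))⁻¹ • fun i => (z (g n) i : ℝ)
  have hγ : ∀ n, γ n ∈ stdSimplex ℝ (Fin m) := by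
    intro n
    refine ⟨fun i => mul_nonneg (inv_nonneg.2 (hpos n).le) (Int.cast_nonneg (hz (g n) i)), ?_⟩
    simp only [γ, Pi.smul_apply, smul_eq_mul]
    rw [← Finset.mul_sum, inv_mul_cancel₀ (hpos n).ne']
  obtain ⟨a, ha, φ, hφ, hlim⟩ := (isCompact_stdSimplex ℝ (Fin m)).tendsto_subseq hγ
  refine ⟨a, ?_, ?_, ?_⟩
  · rintro rfl
    have := ha.2
    simp at this
  · intro i hi
    have h6 : Filter.Tendsto (fun n => γ (φ n) i) Filter.atTop (nhds (a i)) :=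
      ((continuous_apply i).tendsto a).comp hlim
    have h7 : (fun n => γ (φ n) i) = fun _ => 0 := by
      ext n; simp [γ, hzK _ i hi]
    rw [h7] at h6
    exact tendsto_nhds_unique h6 tendsto_const_nhds |>.symm ▸ rfl
  · intro w hw
    obtain ⟨T, hT⟩ := S.exists_T (S.WI_le K hw)
    rw [hT, pos_lc]
    intro i
    have hTc : Continuous T := T.continuous_of_finiteDimensional
    have hTz : ∀ n, T (fun i => (z (g n) i : ℝ)) =
        (fun i => (z (⟨w, hw⟩ * g n) i : ℝ)) - fun i => (z ⟨w, hw⟩ i : ℝ) := by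
      intro n
      apply S.lc_inj
      rw [← hT, map_sub]
      have e1 := hzx (g n)
      have e2 := hzx (⟨w, hw⟩ * g n)
      have e3 := hzx ⟨w, hw⟩
      have e4 : S.lc (fun i => (z (g n) i : ℝ)) = x - (g n : V ≃ₗ[ℝ] V) x := by rw [e1]; abel
      rw [e4, map_sub]
      have e5 : w ((g n : V ≃ₗ[ℝ] V) x) = ((⟨w, hw⟩ * g n : S.WI K) : V ≃ₗ[ℝ] V) x := rfl
      rw [e5, e2]
      have e6 : w x = x - S.lc (fun i => (z ⟨w, hw⟩ i : ℝ)) := e3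
      rw [e6]; abel
    have l1 : Filter.Tendsto (fun n => T (γ (φ n)) i) Filter.atTop (nhds (T a i)) :=
      (((continuous_apply i).comp hTc).tendsto a).comp hlim
    have l2 : Filter.Tendsto (fun n => (∑ i, (z (g (φ n)) i : ℝ))⁻¹ * (z ⟨w, hw⟩ i : ℝ))
        Filter.atTop (nhds 0) := by
      have l3 : Filter.Tendsto (fun n => ∑ i, (z (g (φ n)) i : ℝ)) Filter.atTop Filter.atTop := by
        refine Filter.tendsto_atTop_mono (fun n => ?_) tendsto_natCast_atTop_atTop
        refine le_trans ?_ (hg (φ n)).le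
        exact_mod_cast hφ.id_le n
      simpa using (tendsto_inv_atTop_zero.comp l3).mul_const (z ⟨w, hw⟩ i : ℝ)
    have l4 := l1.add l2
    rw [add_zero] at l4
    refine ge_of_tendsto l4 (Filter.Eventually.of_forall fun n => ?_)
    simp only [γ, map_smul, hTz, Pi.smul_apply, Pi.sub_apply, smul_eq_mul]
    rw [← mul_add, sub_add_cancel]
    exact mul_nonneg (inv_nonneg.2 (hpos _).le) (by exact_mod_cast hz _ i)

/-- Integral points with positive orbit give imaginary-type vectors. -/
theorem int_descent {L : Set (Fin m)} {y0 : Fin m → ℤ} (hy0 : y0 ≠ 0)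
    (hL : ∀ i, i ∉ L → y0 i = 0) (hP : ∀ w ∈ S.WI L, S.Pos (w (S.lc fun i => (y0 i : ℝ)))) :
    ∃ c : Fin m → ℝ, (∀ i, 0 ≤ c i) ∧ c ≠ 0 ∧ (∀ i, i ∉ L → c i = 0) ∧
      ∀ i ∈ L, S.coroot i (S.lc c) ≤ 0 := by
  classical
  let Y : Set (Fin m → ℤ) := {y | y ≠ 0 ∧ (∀ i, i ∉ L → y i = 0) ∧
    ∀ w ∈ S.WI L, S.Pos (w (S.lc fun i => (y i : ℝ)))}
  have hex : ∃ n : ℕ, ∃ y ∈ Y, (∑ i, y i).toNat = n := ⟨_, y0, ⟨hy0, hL, hP⟩, rfl⟩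
  obtain ⟨y, ⟨hy, hyL, hyP⟩, hyn⟩ := Nat.find_spec hex
  have hmin := fun n => Nat.find_min hex (m := n)
  rw [← hyn] at hmin
  have nonneg : ∀ y ∈ Y, ∀ i, 0 ≤ y i := by
    rintro y ⟨-, -, h⟩ i
    have := S.pos_lc.1 (h 1 (Subgroup.one_mem _)) i
    exact_mod_cast this
  refine ⟨fun i => (y i : ℝ), fun i => Int.cast_nonneg (nonneg y ⟨hy, hyL, hyP⟩ i), ?_,
    fun i hi => by simp [hyL i hi], ?_⟩
  · intro h
    apply hy
    ext i
    have := congrFun h i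
    simpa using this
  · intro i hi
    by_contra hcon
    push Not at hcon
    obtain ⟨n, hn⟩ := S.coroot_lc_int i y
    rw [hn] at hcon
    have hn0 : 0 < n := by exact_mod_cast hcon
    have hcast : (fun j => (((y - Pi.single i n : Fin m → ℤ) j : ℤ) : ℝ)) =
        (fun j => (y j : ℝ)) - Pi.single i (n : ℝ) := by
      ext j
      by_cases hj : j = i
      · subst hj; simp
      · simp [hj]
    have hs : S.lc (fun j => (((y - Pi.single i n : Fin m → ℤ) j : ℤ) : ℝ)) =
        S.s i (S.lc fun j => (y j : ℝ)) := by
      rw [hcast, s_lc, hn]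
    have hmem : (y - Pi.single i n) ∈ Y := by
      refine ⟨?_, ?_, ?_⟩
      · intro h0
        rw [h0] at hs
        have h1 : S.s i (S.lc fun j => (y j : ℝ)) = 0 := by
          rw [← hs]
          have : (fun j : Fin m => (((0 : Fin m → ℤ) j : ℤ) : ℝ)) = 0 := by ext; simp
          rw [this, map_zero]
        rw [LinearEquiv.map_eq_zero_iff] at h1
        have h2 : (fun j => (y j : ℝ)) = 0 := S.lc_inj (by rw [h1, map_zero])
        apply hy
        ext j
        have := congrFun h2 j
        simpa using this
      · intro j hj
        have : j ≠ i := by rintro rfl; exact hj hi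
        simp [hyL j hj, this]
      · intro w hw
        rw [hs, ← LinearEquiv.mul_apply]
        exact hyP _ (Subgroup.mul_mem _ hw (S.s_mem_WI hi))
    refine hmin _ ?_ ⟨_, hmem, rfl⟩
    have h1 : 0 ≤ ∑ j, (y - Pi.single i n : Fin m → ℤ) j := Finset.sum_nonneg fun j _ => nonneg _ hmem j
    have h2 : ∑ j, (y - Pi.single i n : Fin m → ℤ) j = ∑ j, y j - n := by
      simp [Finset.sum_sub_distrib]
    omega

theorem infinite_c {K : Set (Fin m)} (hK : ¬ S.FiniteType K) :
    ∃ c : Fin m → ℝ, (∀ i, 0 ≤ c i) ∧ c ≠ 0 ∧ (∀ i, i ∉ K → c i = 0) ∧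
      ∀ i ∈ K, S.coroot i (S.lc c) ≤ 0 := by
  classical
  let R : Set (Fin m → ℝ) := {c | (∀ i, i ∉ K → c i = 0) ∧ ∀ w ∈ S.WI K, S.Pos (w (S.lc c))}
  obtain ⟨γ, hγ0, hγR⟩ : ∃ γ, γ ≠ 0 ∧ γ ∈ R := by
    obtain ⟨c, h1, h2, h3⟩ := S.infinite_cone_ne hK
    exact ⟨c, h1, h2, h3⟩
  by_cases hall : ∀ i ∈ K, S.coroot i (S.lc γ) = 0
  · exact ⟨γ, S.pos_lc.1 (hγR.2 1 (Subgroup.one_mem _)), hγ0, hγR.1, fun i hi => (hall i hi).le⟩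
  push Not at hall
  obtain ⟨i0, hi0K, hi0⟩ := hall
  let U := Submodule.span ℝ R
  have hRs : ∀ c ∈ R, ∀ i ∈ K, (c - Pi.single i (S.coroot i (S.lc c))) ∈ R := by
    rintro c ⟨h1, h2⟩ i hi
    refine ⟨fun j hj => ?_, fun w hw => ?_⟩
    · have : j ≠ i := by rintro rfl; exact hj hi
      simp [h1 j hj, this]
    · rw [← s_lc, ← LinearEquiv.mul_apply]
      exact h2 _ (Subgroup.mul_mem _ hw (S.s_mem_WI hi))
  have hU : ∀ i ∈ K, ∀ v ∈ U, Pi.single i (S.coroot i (S.lc v)) ∈ U := by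
    intro i hi v hv
    induction hv using Submodule.span_induction with
    | mem c hc =>
      have := U.sub_mem (Submodule.subset_span hc) (Submodule.subset_span (hRs c hc i hi))
      simpa using this
    | zero => simp
    | add a b _ _ ha hb =>
      rw [map_add, map_add, Pi.single_add]; exact U.add_mem ha hb
    | smul t a _ ha =>
      rw [map_smul, map_smul]
      have := U.smul_mem t ha
      rwa [← Pi.single_smul] at this
  have hU1 : ∀ i ∈ K, ∀ v ∈ U, S.coroot i (S.lc v) ≠ 0 → Pi.single i 1 ∈ U := by
    intro i hi v hv h0
    have := U.smul_mem (S.coroot i (S.lc v))⁻¹ (hU i hi v hv)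
    rwa [← Pi.single_smul, smul_eq_mul, inv_mul_cancel₀ h0] at this
  let L : Set (Fin m) := {j | j ∈ K ∧ (Pi.single j 1 : Fin m → ℝ) ∈ U}
  have hi0L : i0 ∈ L := ⟨hi0K, hU1 i0 hi0K γ (Submodule.subset_span hγR) hi0⟩
  have hLK : ∀ j ∈ L, ∀ i ∈ K, i ∉ L → S.A j i = 0 := by
    intro j hj i hi hiL
    by_contra hA
    apply hiL
    refine ⟨hi, hU1 i hi _ hj.2 ?_⟩
    rw [lc_single, one_smul, S.pairing]
    intro h
    exact hA ((S.A_zero_iff i j).1 (by exact_mod_cast h))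
  let R' : Set (Fin m → ℝ) := {c | ∀ w ∈ S.WI L, S.Pos (w (S.lc (L.indicator c)))}
  have hadd : ∀ c ∈ R', ∀ d ∈ R', c + d ∈ R' := by
    intro c hc d hd w hw
    rw [Set.indicator_add', map_add, map_add]
    exact (hc w hw).add (hd w hw)
  have hsmul : ∀ t : ℝ, 0 ≤ t → ∀ c ∈ R', t • c ∈ R' := by
    intro t ht c hc w hw
    have : L.indicator (t • c) = t • L.indicator c := by
      ext i; by_cases hi : i ∈ L <;> simp [hi]
    rw [this, map_smul, map_smul]
    exact (hc w hw).smul ht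
  have hsupp : ∀ c : Fin m → ℝ, (∀ i ∈ L, c i = 0) → c ∈ R' := by
    intro c hc w hw
    have : L.indicator c = 0 := by
      ext i; by_cases hi : i ∈ L <;> simp [hi, hc]
    rw [this, map_zero, map_zero]
    exact ⟨0, fun _ => le_rfl, (map_zero _).symm⟩
  have hRR' : R ⊆ R' := by
    rintro c ⟨hcK, hc⟩ w hw
    have hLK' : L ⊆ K := fun i hi => hi.1
    have hwK : w ∈ S.WI K := Subgroup.closure_mono (Set.image_mono hLK') hw
    have hfix : w (S.lc (c - L.indicator c)) = S.lc (c - L.indicator c) := by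
      refine S.word_induct ?_ ?_ w hw
      · rfl
      · intro v _ j hj h
        rw [LinearEquiv.mul_apply, h, s_lc]
        have : S.coroot j (S.lc (c - L.indicator c)) = 0 := by
          rw [coroot_lc]
          refine Finset.sum_eq_zero fun i _ => ?_
          by_cases hiL : i ∈ L
          · simp [hiL]
          · by_cases hiK : i ∈ K
            · simp [hLK j hj i hiK hiL]
            · simp [hiL, hcK i hiK]
        rw [this]; simp
    obtain ⟨d, hd, hdw⟩ := S.supp_WI hw (S.lc (L.indicator c))
    have hcd : w (S.lc (L.indicator c)) = S.lc (L.indicator c - d) := by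
      rw [hdw, map_sub]
    have hpos := hc w hwK
    have hsplit : w (S.lc c) = S.lc (c - d) := by
      have : c = (c - L.indicator c) + L.indicator c := by abel
      conv_lhs => rw [this, map_add, map_add, hfix, hcd, ← map_add]
      congr 1; abel
    rw [hsplit, pos_lc] at hpos
    rw [hcd, pos_lc]
    intro i
    by_cases hi : i ∈ L
    · have := hpos i
      simpa [hi] using this
    · simp [hi, hd i hi]
  have hconv : Convex ℝ R' := by
    intro c hc d hd a b ha hb _
    exact hadd _ (hsmul a ha c hc) _ (hsmul b hb d hd)
  have h0R' : (0 : Fin m → ℝ) ∈ R' := hsupp 0 (fun _ _ => rfl)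
  have hspan : Submodule.span ℝ R' = ⊤ := by
    rw [eq_top_iff]
    rintro c -
    have : c = ∑ i, c i • (Pi.single i 1 : Fin m → ℝ) := by
      ext j; simp [Finset.sum_apply, Pi.single_apply]
    rw [this]
    refine Submodule.sum_mem _ fun i _ => Submodule.smul_mem _ _ ?_
    by_cases hi : i ∈ L
    · exact Submodule.span_mono hRR' hi.2
    · refine Submodule.subset_span (hsupp _ fun j hj => ?_)
      have : j ≠ i := by rintro rfl; exact hi hj
      simp [this]
  have hInterior : (interior R').Nonempty := by
    rw [hconv.interior_nonempty_iff_affineSpan_eq_top]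
    rw [AffineSubspace.affineSpan_eq_top_iff_vectorSpan_eq_top_of_nonempty ℝ _ _ ⟨0, h0R'⟩]
    rw [eq_top_iff, ← hspan, Submodule.span_le]
    intro c hc
    have := vsub_mem_vectorSpan ℝ hc h0R'
    simpa using this
  obtain ⟨q, hq⟩ : ∃ q : Fin m → ℚ, (fun i => (q i : ℝ)) ∈ interior R' := by
    have hd : DenseRange (fun (q : Fin m → ℚ) (i : Fin m) => (q i : ℝ)) :=
      DenseRange.piMap (fun _ => Rat.denseRange_cast)
    obtain ⟨q, hq⟩ := hd.exists_mem_open isOpen_interior hInterior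
    exact ⟨q, hq⟩
  have hqpos : 0 < (q i0 : ℝ) := by
    by_contra hcon
    push Not at hcon
    have hcont : Filter.Tendsto (fun t : ℝ => (fun i => (q i : ℝ)) - Pi.single i0 t)
        (nhds 0) (nhds (fun i => (q i : ℝ))) := by
      have : Continuous (fun t : ℝ => (fun i => (q i : ℝ)) - Pi.single i0 t) :=
        continuous_const.sub (continuous_single (A := fun _ : Fin m => ℝ) i0)
      simpa using this.tendsto 0
    have hev := hcont (isOpen_interior.mem_nhds hq)
    obtain ⟨ε, hε, hball⟩ := Metric.mem_nhds_iff.1 hev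
    have hm : (ε / 2) ∈ Metric.ball (0 : ℝ) ε := by
      rw [Metric.mem_ball, dist_zero_right, Real.norm_eq_abs, abs_of_pos (by linarith)]; linarith
    have h1 := interior_subset (hball hm)
    have h2 := S.pos_lc.1 (h1 1 (Subgroup.one_mem _)) i0
    simp [hi0L] at h2
    linarith
  have hqR := interior_subset hq
  let N : ℕ := ∏ i, (q i).den
  have hN : 0 < N := Finset.prod_pos fun i _ => (q i).den_pos
  have hz : ∀ i, ∃ z : ℤ, (z : ℝ) = N * (q i : ℝ) := by
    intro i
    obtain ⟨k, hk⟩ : (q i).den ∣ N := Finset.dvd_prod_of_mem _ (Finset.mem_univ i)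
    refine ⟨k * (q i).num, ?_⟩
    have h1 : ((q i).den : ℚ) * q i = (q i).num := Rat.den_mul_eq_num (q i)
    have h2 : ((q i).den : ℝ) * (q i : ℝ) = (q i).num := by exact_mod_cast h1
    rw [hk]; push_cast
    rw [← h2]; ring
  choose z hz using hz
  have hzR : (fun i => (z i : ℝ)) ∈ R' := by
    have : (fun i => (z i : ℝ)) = (N : ℝ) • fun i => (q i : ℝ) := by
      ext i; simp [hz]
    rw [this]
    exact hsmul _ (Nat.cast_nonneg N) _ hqR
  have hind : (fun i => ((L.indicator z i : ℤ) : ℝ)) = L.indicator (fun i => (z i : ℝ)) := by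
    ext i; by_cases hi : i ∈ L <;> simp [hi]
  obtain ⟨c, h1, h2, h3, h4⟩ := S.int_descent (L := L) (y0 := L.indicator z) (by
      intro h
      have := congrFun h i0
      simp only [hi0L, Set.indicator_of_mem, Pi.zero_apply] at this
      have h5 := hz i0
      rw [this] at h5
      have : (0 : ℝ) < N := by exact_mod_cast hN
      have := mul_pos this hqpos
      simp at h5
      rcases h5 with h5 | h5
      · omega
      · rw [h5] at hqpos; simp at hqpos) (fun i hi => by simp [hi])
    (fun w hw => by rw [hind]; exact hzR w hw)
  refine ⟨c, h1, h2, fun i hi => h3 i (fun h => hi h.1), fun i hi => ?_⟩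
  by_cases hiL : i ∈ L
  · exact h4 i hiL
  · exact S.coroot_nonpos h1 (h3 i hiL)

end helpers3

end GCMRealization

namespace GCMRealization

section helpers4

variable {m : ℕ} {V : Type*} [NormedAddCommGroup V] [NormedSpace ℝ V]
variable (S : GCMRealization m V)

theorem hull_convex (μ : V) : Convex ℝ (S.orbitHull μ) := convex_convexHull ℝ _

theorem mem_hull (μ : V) : μ ∈ S.orbitHull μ :=
  subset_convexHull ℝ _ ⟨1, Subgroup.one_mem _, rfl⟩

theorem hull_inv {μ v : V} (hv : v ∈ S.orbitHull μ) {w : V ≃ₗ[ℝ] V} (hw : w ∈ S.W) :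
    w v ∈ S.orbitHull μ := by
  have h1 : S.orbitHull μ ⊆ w ⁻¹' S.orbitHull μ := by
    apply convexHull_min
    · rintro _ ⟨g, hg, rfl⟩
      exact subset_convexHull ℝ _ ⟨w * g, Subgroup.mul_mem _ hw hg, rfl⟩
    · exact (S.hull_convex μ).linear_preimage w.toLinearMap
  exact h1 hv

/-- Restriction of coordinates to an index set, as a linear map. -/
noncomputable def indL (I : Set (Fin m)) : (Fin m → ℝ) →ₗ[ℝ] (Fin m → ℝ) where
  toFun c := I.indicator c
  map_add' c d := Set.indicator_add' I c d
  map_smul' t c := by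
    classical
    ext i; by_cases hi : i ∈ I <;> simp [hi]

theorem indL_mem {I : Set (Fin m)} {i : Fin m} (hi : i ∈ I) (c : Fin m → ℝ) :
    indL I c i = c i := Set.indicator_of_mem hi c

theorem indL_not {I : Set (Fin m)} {i : Fin m} (hi : i ∉ I) (c : Fin m → ℝ) :
    indL I c i = 0 := Set.indicator_of_notMem hi c

theorem indL_single {I : Set (Fin m)} {i : Fin m} (hi : i ∈ I) (t : ℝ) :
    indL I (Pi.single i t) = Pi.single i t := by
  ext j
  by_cases hj : j ∈ I
  · rw [indL_mem hj]
  · have : j ≠ i := by rintro rfl; exact hj hi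
    rw [indL_not hj]; simp [this]

theorem closure_mem {μ : V} (hμ : μ ∈ S.chamber) {I : Set (Fin m)} (hI : S.MC μ I)
    {c : Fin m → ℝ} (hc : ∀ i ∈ I, 0 < c i)
    (hle : ∀ i ∈ I, S.coroot i (S.lc (indL I c)) ≤ S.coroot i μ) :
    c ∈ closure {c : Fin m → ℝ | μ - S.lc (indL I c) ∈ S.orbitHull μ} := by
  classical
  set Hc : Set (Fin m → ℝ) := {c | μ - S.lc (indL I c) ∈ S.orbitHull μ} with hHc
  have hconv : Convex ℝ Hc := by
    intro x hx y hy a b ha hb hab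
    have := S.hull_convex μ hx hy ha hb hab
    simp only [hHc, Set.mem_ofPred_eq, map_add, map_smul]
    convert this using 1
    have : μ = a • μ + b • μ := by rw [← add_smul, hab, one_smul]
    conv_lhs => rw [this]
    module
  let ℓ : Fin m → ℝ := fun i => if i ∈ I then 0 else c i
  have hℓ : ℓ ∈ Hc := by
    have : indL I ℓ = 0 := by
      ext i
      by_cases hi : i ∈ I
      · rw [indL_mem hi]; simp [ℓ, hi]
      · rw [indL_not hi]; rfl
    simp only [hHc, Set.mem_ofPred_eq, this, map_zero, sub_zero]
    exact S.mem_hull μ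
  have hℓc : ℓ ≤ c := by
    intro i
    by_cases hi : i ∈ I
    · simpa [ℓ, hi] using (hc i hi).le
    · simp [ℓ, hi]
  have hcomp : IsCompact (Set.Icc ℓ c ∩ closure Hc) := isCompact_Icc.inter_right isClosed_closure
  obtain ⟨g, ⟨hgI, hgcl⟩, hmax⟩ := hcomp.exists_isMaxOn ⟨ℓ, ⟨le_rfl, hℓc⟩, subset_closure hℓ⟩
    (f := fun g : Fin m → ℝ => ∑ i, g i) (by fun_prop)
  have hoff : ∀ i, i ∉ I → g i = c i := by
    intro i hi
    have h1 := hgI.1 i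
    simp only [ℓ, hi, if_false] at h1
    exact le_antisymm (hgI.2 i) h1
  have hon : ∀ i ∈ I, 0 ≤ g i := by
    intro i hi
    have h1 := hgI.1 i
    simpa [ℓ, hi] using h1
  have hkey : ∀ i ∈ I, g i < c i → S.coroot i μ ≤ S.coroot i (S.lc (indL I g)) := by
    intro i hi hlt
    by_contra hcon
    push Not at hcon
    let φ : (Fin m → ℝ) → (Fin m → ℝ) := fun x =>
      x + Pi.single i (S.coroot i μ - S.coroot i (S.lc (indL I x)))
    have hφc : Continuous φ := by
      have h1 : Continuous (fun x : Fin m → ℝ => S.coroot i (S.lc (indL I x))) :=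
        ((S.coroot i).comp (S.lc.comp (indL I))).continuous_of_finiteDimensional
      have h2 := (continuous_single (A := fun _ : Fin m => ℝ) i).comp
        ((continuous_const (y := S.coroot i μ)).sub h1)
      exact continuous_id.add h2
    have hφH : Set.MapsTo φ Hc Hc := by
      intro x hx
      have h1 := S.hull_inv hx (S.s_mem i)
      simp only [hHc, Set.mem_ofPred_eq, φ, map_add, indL_single hi, lc_single]
      convert h1 using 1
      rw [s_apply, map_sub]
      abel
    have hg' : φ g ∈ closure Hc := hφH.closure hφc hgcl
    set d := S.coroot i μ - S.coroot i (S.lc (indL I g)) with hd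
    have hd0 : 0 < d := by rw [hd]; linarith
    let ε := min d (c i - g i)
    have hε0 : 0 < ε := lt_min hd0 (by linarith)
    have hε1 : ε ≤ d := min_le_left _ _
    have hε2 : ε ≤ c i - g i := min_le_right _ _
    have hmem : g + Pi.single i ε ∈ closure Hc := by
      have h1 := hconv.closure hgcl hg' (a := 1 - ε / d) (b := ε / d)
        (by rw [sub_nonneg, div_le_one hd0]; exact hε1) (by positivity) (by ring)
      convert h1 using 1
      have : (Pi.single i ε : Fin m → ℝ) = (ε / d) • Pi.single i d := by
        rw [← Pi.single_smul, smul_eq_mul, div_mul_cancel₀ _ hd0.ne']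
      simp only [φ, ← hd]
      rw [this]; module
    have hIcc : g + Pi.single i ε ∈ Set.Icc ℓ c := by
      refine ⟨hgI.1.trans ?_, ?_⟩
      · intro j
        by_cases hj : j = i
        · subst hj; simp [hε0.le]
        · simp [hj]
      · intro j
        by_cases hj : j = i
        · subst hj; simp; linarith
        · simpa [hj] using hgI.2 j
    have h2 := hmax ⟨hIcc, hmem⟩
    simp [Finset.sum_add_distrib] at h2
    linarith
  have hp0 : indL I (c - g) = 0 := by
    have hpn : ∀ i, indL I (c - g) i ≠ 0 → i ∈ I ∧ g i < c i := by
      intro i hi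
      have hiI : i ∈ I := by by_contra h; exact hi (indL_not h _)
      refine ⟨hiI, lt_of_le_of_ne (hgI.2 i) fun h => hi ?_⟩
      rw [indL_mem hiI, Pi.sub_apply, h, sub_self]
    refine S.mc_lemma hμ hI (g := indL I g) ?_ ?_ (fun i hi => indL_not hi _)
      (fun i hi => indL_not hi _) ?_ ?_ ?_
    · intro i
      by_cases hi : i ∈ I
      · rw [indL_mem hi]; exact hon i hi
      · rw [indL_not hi]
    · intro i
      by_cases hi : i ∈ I
      · rw [indL_mem hi]; exact sub_nonneg.2 (hgI.2 i)
      · rw [indL_not hi]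
    · intro i hi
      rw [indL_mem hi, indL_mem hi]
      simpa using hc i hi
    · intro i hi
      exact hkey i (hpn i hi).1 (hpn i hi).2
    · intro i hi
      rw [map_sub, map_sub, map_sub]
      have := hkey i (hpn i hi).1 (hpn i hi).2
      have := hle i (hpn i hi).1
      linarith
  have : c = g := by
    ext i
    by_cases hi : i ∈ I
    · have := congrFun hp0 i
      rw [indL_mem hi] at this
      simpa [sub_eq_zero] using this
    · exact (hoff i hi).symm
  rw [this]; exact hgcl

theorem strict_mem {μ : V} (hμ : μ ∈ S.chamber) {I : Set (Fin m)} (hI : S.MC μ I)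
    {c : Fin m → ℝ} (hc : ∀ i ∈ I, 0 < c i)
    (hlt : ∀ i ∈ I, S.coroot i (S.lc (indL I c)) < S.coroot i μ) :
    μ - S.lc (indL I c) ∈ S.orbitHull μ := by
  classical
  set Hc : Set (Fin m → ℝ) := {c | μ - S.lc (indL I c) ∈ S.orbitHull μ} with hHc
  have hconv : Convex ℝ Hc := by
    intro x hx y hy a b ha hb hab
    have := S.hull_convex μ hx hy ha hb hab
    simp only [hHc, Set.mem_ofPred_eq, map_add, map_smul]
    convert this using 1
    have : μ = a • μ + b • μ := by rw [← add_smul, hab, one_smul]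
    conv_lhs => rw [this]
    module
  have hopen : IsOpen {c : Fin m → ℝ | ∀ i, i ∈ I →
      (0 < c i ∧ S.coroot i (S.lc (indL I c)) < S.coroot i μ)} := by
    simp only [Set.ofPred_forall]
    refine isOpen_iInter_of_finite fun i => isOpen_iInter_of_finite fun _ => ?_
    have h1 : Continuous (fun x : Fin m → ℝ => S.coroot i (S.lc (indL I x))) :=
      ((S.coroot i).comp (S.lc.comp (indL I))).continuous_of_finiteDimensional
    exact (isOpen_lt continuous_const (continuous_apply i)).inter (isOpen_lt h1 continuous_const)
  have hsub : {c : Fin m → ℝ | ∀ i, i ∈ I →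
      (0 < c i ∧ S.coroot i (S.lc (indL I c)) < S.coroot i μ)} ⊆ closure Hc := fun x hx =>
    S.closure_mem hμ hI (fun i hi => (hx i hi).1) (fun i hi => (hx i hi).2.le)
  have hInterior : c ∈ interior (closure Hc) :=
    interior_maximal hsub hopen (fun i hi => ⟨hc i hi, hlt i hi⟩)
  have hne : (interior Hc).Nonempty := by
    rw [hconv.interior_nonempty_iff_affineSpan_eq_top]
    have h1 := (hconv.closure.interior_nonempty_iff_affineSpan_eq_top).1 ⟨c, hInterior⟩
    rw [eq_top_iff, ← h1]
    apply affineSpan_le.2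
    exact closure_minimal (subset_affineSpan ℝ _) (affineSpan ℝ Hc).closed_of_finiteDimensional
  rw [hconv.interior_closure_eq_interior_of_nonempty_interior hne] at hInterior
  have hfinal : c ∈ Hc := interior_subset hInterior
  exact hfinal

theorem mem_of_le {μ : V} (hμ : μ ∈ S.chamber) {I : Set (Fin m)} (hI : S.MC μ I)
    {c : Fin m → ℝ} (hcI : ∀ i, i ∉ I → c i = 0) (hc : ∀ i ∈ I, 0 < c i)
    (hle : ∀ i ∈ I, S.coroot i (S.lc c) ≤ S.coroot i μ) :
    μ - S.lc c ∈ S.orbitHull μ := by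
  classical
  have hc0 : ∀ i, 0 ≤ c i := by
    intro i
    by_cases hi : i ∈ I
    · exact (hc i hi).le
    · exact (hcI i hi).ge
  let Z : Set (Fin m) := {i | i ∈ I ∧ S.coroot i (S.lc c) = S.coroot i μ}
  have hZ : S.FiniteType Z := by
    by_contra hcon
    obtain ⟨p, hp0, hpne, hpZ, hp⟩ := S.infinite_c hcon
    have hpz : ∀ i, p i ≠ 0 → i ∈ Z := fun i hi => by by_contra h; exact hi (hpZ i h)
    apply hpne
    refine S.mc_lemma hμ hI hc0 hp0 hcI (fun i hi => hpZ i fun h => hi h.1)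
      (fun i hi => add_pos_of_pos_of_nonneg (hc i hi) (hp0 i)) ?_ ?_
    · intro i hi; exact (hpz i hi).2.ge
    · intro i hi; exact hp i (hpz i hi)
  obtain ⟨u, hu0, huZ, hu, hAu⟩ := S.fin_u hZ
  have hex : ∃ t : ℝ, 0 < t ∧ ∀ i ∈ I, 0 < c i - t * u i ∧
      S.coroot i (S.lc c) - t * S.coroot i (S.lc u) < S.coroot i μ := by
    have hev : ∀ i, ∀ᶠ t in nhdsWithin (0 : ℝ) (Set.Ioi 0), i ∈ I → (0 < c i - t * u i ∧
      S.coroot i (S.lc c) - t * S.coroot i (S.lc u) < S.coroot i μ) := by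
      intro i
      by_cases hi : i ∈ I
      · have h1 : ∀ᶠ t in nhdsWithin (0 : ℝ) (Set.Ioi 0), 0 < c i - t * u i := by
          have : Filter.Tendsto (fun t : ℝ => c i - t * u i) (nhds 0) (nhds (c i - 0 * u i)) :=
            Continuous.tendsto (by fun_prop) 0
          refine (this.mono_left nhdsWithin_le_nhds).eventually (lt_mem_nhds ?_)
          simpa using hc i hi
        have h2 : ∀ᶠ t in nhdsWithin (0 : ℝ) (Set.Ioi 0),
            S.coroot i (S.lc c) - t * S.coroot i (S.lc u) < S.coroot i μ := by
          rcases (hle i hi).eq_or_lt with h | h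
          · filter_upwards [self_mem_nhdsWithin] with t ht
            have := mul_pos (show (0:ℝ) < t from ht) (hAu i ⟨hi, h⟩)
            linarith
          · have : Filter.Tendsto (fun t : ℝ => S.coroot i (S.lc c) - t * S.coroot i (S.lc u))
                (nhds 0) (nhds (S.coroot i (S.lc c) - 0 * S.coroot i (S.lc u))) :=
              Continuous.tendsto (by fun_prop) 0
            refine (this.mono_left nhdsWithin_le_nhds).eventually (gt_mem_nhds ?_)
            simpa using h
        filter_upwards [h1, h2] with t h3 h4 _ using ⟨h3, h4⟩
      · exact Filter.Eventually.of_forall fun t h => absurd h hi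
    have hall := Filter.eventually_all.2 hev
    obtain ⟨t, ht, ht0⟩ := (hall.and self_mem_nhdsWithin).exists
    exact ⟨t, ht0, ht⟩
  obtain ⟨t, ht0, ht⟩ := hex
  have hindc : indL I (c - t • u) = c - t • u := by
    ext i
    by_cases hi : i ∈ I
    · rw [indL_mem hi]
    · rw [indL_not hi]; simp [hcI i hi, huZ i (fun h => hi h.1)]
  have hmem := S.strict_mem hμ hI (c := c - t • u) (fun i hi => by simpa using (ht i hi).1)
    (fun i hi => by rw [hindc]; simpa using (ht i hi).2)
  rw [hindc] at hmem
  have hfin : Finite (S.WI Z) := hZ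
  have := Fintype.ofFinite (S.WI Z)
  have hfix : ∀ g : S.WI Z, (g : V ≃ₗ[ℝ] V) (μ - S.lc c) = μ - S.lc c := by
    rintro ⟨g, hg⟩
    refine S.WI_J0_fix (Subgroup.closure_mono (Set.image_mono ?_) hg)
    intro i hi
    have := hi.2
    simp [J0, this]
  have hsum : ∑ g : S.WI Z, (g : V ≃ₗ[ℝ] V) (S.lc u) = 0 := by
    have h1 : ∀ g : S.WI Z, ∃ e : Fin m → ℝ, (∀ i, i ∉ Z → e i = 0) ∧
        (g : V ≃ₗ[ℝ] V) (S.lc u) = S.lc e := by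
      rintro ⟨g, hg⟩
      obtain ⟨d, hd, h⟩ := S.supp_WI hg (S.lc u)
      refine ⟨u - d, fun i hi => by simp [huZ i hi, hd i hi], ?_⟩
      rw [map_sub]; exact h
    choose e he hge using h1
    have h2 : ∑ g : S.WI Z, (g : V ≃ₗ[ℝ] V) (S.lc u) = S.lc (∑ g, e g) := by
      rw [map_sum]; exact Finset.sum_congr rfl fun g _ => hge g
    have hz : ∀ i ∈ Z, S.coroot i (S.lc (∑ g, e g)) = 0 := by
      intro i hi; rw [← h2]; exact S.avg_fixed hi _
    have hsuppE : ∀ i, i ∉ Z → (∑ g, e g) i = 0 := by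
      intro i hi
      rw [Finset.sum_apply]
      exact Finset.sum_eq_zero fun g _ => he g i hi
    have h3 : (∑ g, e g) = 0 := by
      ext i
      apply le_antisymm
      · exact S.fin_nonpos hZ hsuppE (fun i hi => (hz i hi).le) i
      · have := S.fin_nonpos hZ (p := -(∑ g, e g)) (fun i hi => by
          rw [Pi.neg_apply, hsuppE i hi, neg_zero]) (fun i hi => by
          rw [map_neg, map_neg, hz i hi, neg_zero]) i
        rw [Pi.neg_apply] at this
        simpa using this
    rw [h2, h3, map_zero]
  have hN : (0 : ℝ) < Fintype.card (S.WI Z) := by exact_mod_cast Fintype.card_pos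
  have havg : ∑ g : S.WI Z, (Fintype.card (S.WI Z) : ℝ)⁻¹ •
      (g : V ≃ₗ[ℝ] V) (μ - S.lc (c - t • u)) ∈ S.orbitHull μ := by
    refine (S.hull_convex μ).sum_mem (fun _ _ => (inv_pos.2 hN).le) ?_
      (fun g _ => S.hull_inv hmem (S.WI_le Z g.2))
    rw [Finset.sum_const, nsmul_eq_mul, Finset.card_univ, mul_inv_cancel₀ hN.ne']
  convert havg using 1
  have h5 : ∀ g : S.WI Z, (g : V ≃ₗ[ℝ] V) (μ - S.lc (c - t • u)) =
      (μ - S.lc c) + t • (g : V ≃ₗ[ℝ] V) (S.lc u) := by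
    intro g
    have h6 : μ - S.lc (c - t • u) = (μ - S.lc c) + t • S.lc u := by
      rw [map_sub, map_smul]; abel
    rw [h6, map_add, hfix g, map_smul]
  simp only [h5]
  rw [← Finset.smul_sum, Finset.sum_add_distrib, ← Finset.smul_sum, hsum, smul_zero, add_zero,
    Finset.sum_const, Finset.card_univ, ← Nat.cast_smul_eq_nsmul ℝ, smul_smul,
    inv_mul_cancel₀ hN.ne', one_smul]

end helpers4

end GCMRealization

namespace GCMRealization

section helpers5

variable {m : ℕ} {V : Type*} [NormedAddCommGroup V] [NormedSpace ℝ V]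
variable (S : GCMRealization m V)

theorem adj_of_A {i j : Fin m} (hij : i ≠ j) (h : S.A i j ≠ 0) : S.diagram.Adj i j :=
  ⟨hij, h, fun h0 => h ((S.A_zero_iff j i).1 h0)⟩

theorem muP_self {μ : V} {i : Fin m} (hi : S.coroot i μ ≠ 0) : i ∈ S.muPart μ Set.univ :=
  ⟨Set.mem_univ i, i, Set.mem_univ i, hi, SimpleGraph.Reachable.refl _⟩

theorem muP_nbr {μ : V} {i j : Fin m} (h : S.A i j ≠ 0) (hj : j ∈ S.muPart μ Set.univ) :
    i ∈ S.muPart μ Set.univ := by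
  by_cases hij : i = j
  · rwa [hij]
  obtain ⟨hj', k, hk, hkμ, hr⟩ := hj
  refine ⟨Set.mem_univ i, k, hk, hkμ, SimpleGraph.Reachable.trans ?_ hr⟩
  apply SimpleGraph.Adj.reachable
  exact S.adj_of_A hij h

theorem MC_P (μ : V) : S.MC μ (S.muPart μ Set.univ) := by
  intro R hR hne h0
  by_contra hcon
  push Not at hcon
  obtain ⟨i, hi⟩ := hne
  obtain ⟨hi', k, hk, hkμ, ⟨p⟩⟩ := hR hi
  have hwalk : ∀ (a b : (Set.univ : Set (Fin m))) (_ : (S.diagram.induce Set.univ).Walk a b),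
      (a : Fin m) ∈ R → (b : Fin m) ∈ R := by
    intro a b p
    induction p with
    | nil => exact id
    | @cons u v w h _ ih =>
      intro hu
      apply ih
      by_contra hv
      have hadj : S.diagram.Adj (u : Fin m) v := h
      exact hadj.2.1 (hcon u hu v (S.muP_nbr hadj.2.2 (hR hu)) hv)
  exact hkμ (h0 k (hwalk _ _ p hi))

theorem comp_self {M : Set (Fin m)} {i : Fin m} (hi : i ∈ M) : i ∈ S.comp M i :=
  ⟨hi, hi, SimpleGraph.Reachable.refl _⟩

theorem comp_sub {M : Set (Fin m)} {i : Fin m} : S.comp M i ⊆ M := fun _ h => h.2.1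

theorem comp_nbr {M : Set (Fin m)} {i j k : Fin m} (hj : j ∈ S.comp M i) (hk : k ∈ M)
    (h : S.A j k ≠ 0) : k ∈ S.comp M i := by
  by_cases hjk : j = k
  · rwa [← hjk]
  obtain ⟨hi, hj', hr⟩ := hj
  refine ⟨hi, hk, hr.trans ?_⟩
  apply SimpleGraph.Adj.reachable
  exact S.adj_of_A hjk h

theorem hull_sub {μ : V} (hμ : μ ∈ S.chamber) {v : V} (hv : v ∈ S.orbitHull μ) :
    ∃ c : Fin m → ℝ, (∀ i, 0 ≤ c i) ∧ (∀ i, i ∉ S.muPart μ Set.univ → c i = 0) ∧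
      ((∀ j, S.coroot j μ ≠ 0 → c j = 0) → c = 0) ∧ v = μ - S.lc c := by
  have hsub : S.orbitHull μ ⊆ {v | ∃ c : Fin m → ℝ, (∀ i, 0 ≤ c i) ∧
      (∀ i, i ∉ S.muPart μ Set.univ → c i = 0) ∧
      ((∀ j, S.coroot j μ ≠ 0 → c j = 0) → c = 0) ∧ v = μ - S.lc c} := by
    apply convexHull_min
    · rintro _ ⟨w, hw, rfl⟩
      have hw' : w ∈ S.W := hw
      obtain ⟨c, hc, hcw, hJ⟩ := S.pos_sub_J0 hμ hw'
      have hd : ∃ d : Fin m → ℝ, (∀ i, i ∉ S.muPart μ Set.univ → d i = 0) ∧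
          w μ = μ - S.lc d := by
        rw [W_eq] at hw'
        refine S.word_induct (P := fun w => ∃ d : Fin m → ℝ,
          (∀ i, i ∉ S.muPart μ Set.univ → d i = 0) ∧ w μ = μ - S.lc d) ?_ ?_ w hw'
        · exact ⟨0, by simp, by simp⟩
        · rintro w _ i _ ⟨d, hd, h⟩
          by_cases hi : i ∈ S.muPart μ Set.univ
          · refine ⟨d + Pi.single i (S.coroot i (w μ)), fun j hj => ?_, ?_⟩
            · have : j ≠ i := by rintro rfl; exact hj hi
              simp [hd j hj, this]
            · rw [LinearEquiv.mul_apply, s_apply, map_add, lc_single, ← sub_sub, ← h]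
          · refine ⟨d, hd, ?_⟩
            have h1 : S.coroot i μ = 0 := by by_contra h0; exact hi (S.muP_self h0)
            have h2 : S.coroot i (S.lc d) = 0 := by
              rw [coroot_lc]
              refine Finset.sum_eq_zero fun j _ => ?_
              by_cases hj : j ∈ S.muPart μ Set.univ
              · have : S.A i j = 0 := by by_contra h0; exact hi (S.muP_nbr h0 hj)
                simp [this]
              · simp [hd j hj]
            rw [LinearEquiv.mul_apply, h, s_apply, map_sub, h1, h2]; simp
      obtain ⟨d, hd, hdw⟩ := hd
      have hcd : c = d := by
        apply S.lc_inj
        rw [hcw] at hdw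
        simpa using hdw
      refine ⟨c, hc, by rw [hcd]; exact hd, fun h => ?_, hcw⟩
      rcases hJ with hJ | ⟨j, hj, hcj⟩
      · apply S.lc_inj
        rw [S.WI_J0_fix hJ] at hcw
        rw [map_zero]
        simpa using hcw.symm
      · exact absurd (h j hj) hcj.ne'
    · rintro _ ⟨c, hc, hcP, hcJ, rfl⟩ _ ⟨d, hd, hdP, hdJ, rfl⟩ a b ha hb hab
      refine ⟨a • c + b • d, fun i => ?_, fun i hi => by simp [hcP i hi, hdP i hi], ?_, ?_⟩
      · have := mul_nonneg ha (hc i)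
        have := mul_nonneg hb (hd i)
        simp; linarith
      · intro h
        have h1 : a • c = 0 := by
          by_cases ha0 : a = 0
          · rw [ha0, zero_smul]
          · rw [hcJ fun j hj => ?_, smul_zero]
            have h3 := h j hj
            have h4 := mul_nonneg ha (hc j)
            have h5 := mul_nonneg hb (hd j)
            simp only [Pi.add_apply, Pi.smul_apply, smul_eq_mul] at h3
            have h6 : a * c j = 0 := by linarith
            exact (mul_eq_zero.1 h6).resolve_left ha0
        have h2 : b • d = 0 := by
          by_cases hb0 : b = 0
          · rw [hb0, zero_smul]
          · rw [hdJ fun j hj => ?_, smul_zero]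
            have h3 := h j hj
            have h4 := mul_nonneg ha (hc j)
            have h5 := mul_nonneg hb (hd j)
            simp only [Pi.add_apply, Pi.smul_apply, smul_eq_mul] at h3
            have h6 : b * d j = 0 := by linarith
            exact (mul_eq_zero.1 h6).resolve_left hb0
        rw [h1, h2, add_zero]
      · rw [map_add, map_smul, map_smul]
        have : μ = a • μ + b • μ := by rw [← add_smul, hab, one_smul]
        conv_rhs => rw [this]
        module
  exact hsub hv

theorem full_support {μ : V} (hμ : μ ∈ S.chamber) :
    ∃ c : Fin m → ℝ, (∀ i, i ∉ S.muPart μ Set.univ → c i = 0) ∧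
      (∀ i ∈ S.muPart μ Set.univ, 0 < c i) ∧ ∀ i, S.coroot i (S.lc c) ≤ S.coroot i μ := by
  classical
  set P := S.muPart μ Set.univ with hP
  let F : Set (Finset (Fin m)) := {s | ∃ c : Fin m → ℝ, (∀ i, 0 ≤ c i) ∧ (∀ i, i ∉ P → c i = 0) ∧
    (∀ i, S.coroot i (S.lc c) ≤ S.coroot i μ) ∧ s = Finset.univ.filter fun i => c i ≠ 0}
  have hF : F.Nonempty := ⟨_, 0, fun _ => le_rfl, fun _ _ => rfl, fun i => by
    simpa using hμ i, rfl⟩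
  obtain ⟨s, hs⟩ := (Set.toFinite F).exists_maximal hF
  obtain ⟨c, hc, hcP, hcμ, hsc⟩ := hs.prop
  refine ⟨c, hcP, ?_, hcμ⟩
  by_contra hcon
  push Not at hcon
  obtain ⟨k, hkP, hk⟩ := hcon
  have hk0 : c k = 0 := le_antisymm hk (hc k)
  have hslack : ∃ i ∈ P, c i = 0 ∧ S.coroot i (S.lc c) < S.coroot i μ := by
    by_cases hR : ∀ i ∈ {i | i ∈ P ∧ c i = 0}, S.coroot i μ = 0
    · obtain ⟨i, hi, j, hj, hjR, hA⟩ := S.MC_P μ {i | i ∈ P ∧ c i = 0} (fun i hi => hi.1)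
        ⟨k, hkP, hk0⟩ hR
      refine ⟨i, hi.1, hi.2, ?_⟩
      rw [hR i hi]
      by_contra hle
      push Not at hle
      exact hjR ⟨hj, S.coroot_zero_nbr hc hi.2 hle hA⟩
    · push Not at hR
      obtain ⟨i, hi, hiμ⟩ := hR
      exact ⟨i, hi.1, hi.2, lt_of_le_of_lt (S.coroot_nonpos hc hi.2)
        (lt_of_le_of_ne (hμ i) (Ne.symm hiμ))⟩
  obtain ⟨i, hiP, hi0, hlt⟩ := hslack
  set δ := (S.coroot i μ - S.coroot i (S.lc c)) / 2 with hδ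
  have hδ0 : 0 < δ := by rw [hδ]; linarith
  have hmem : (Finset.univ.filter fun j => (c + Pi.single i δ : Fin m → ℝ) j ≠ 0) ∈ F := by
    refine ⟨c + Pi.single i δ, fun j => ?_, fun j hj => ?_, fun j => ?_, rfl⟩
    · by_cases hj : j = i
      · subst hj; simp [hi0, hδ0.le]
      · simpa [hj] using hc j
    · have : j ≠ i := by rintro rfl; exact hj hiP
      simp [hcP j hj, this]
    · rw [map_add, map_add, lc_single, map_smul, S.pairing, smul_eq_mul]
      by_cases hj : j = i
      · subst hj
        rw [S.A_diag]; push_cast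
        linarith
      · have h1 : (S.A j i : ℝ) ≤ 0 := by exact_mod_cast S.A_offdiag j i hj
        have := mul_nonpos_of_nonneg_of_nonpos hδ0.le h1
        have := hcμ j
        linarith
  have hle : s ≤ Finset.univ.filter fun j => (c + Pi.single i δ : Fin m → ℝ) j ≠ 0 := by
    rw [hsc]
    intro j hj
    simp only [Finset.mem_filter, Finset.mem_univ, true_and] at hj ⊢
    have : j ≠ i := by rintro rfl; exact hj hi0
    simpa [this] using hj
  have h3 := hs.le_of_ge hmem hle
  have h4 : i ∈ s := h3 (by simp [hi0, hδ0.ne'])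
  rw [hsc] at h4
  simp [hi0] at h4

theorem lc_cont : Continuous S.lc := by
  have := S.finDim
  exact S.lc.continuous_of_finiteDimensional

theorem chamber_closed : IsClosed S.chamber := by
  have := S.finDim
  have : S.chamber = ⋂ i, {η | 0 ≤ S.coroot i η} := by ext; simp [chamber]
  rw [this]
  exact isClosed_iInter fun i =>
    isClosed_le continuous_const (S.coroot i).continuous_of_finiteDimensional

theorem dir_closed {μ : V} (hμ : μ ∈ S.chamber)
    (hfin : S.FinTypeComponents (S.muPart μ Set.univ ∩ S.J0 μ)) :
    IsClosed (S.orbitHull μ ∩ S.chamber) := by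
  classical
  have := S.finDim
  let D : Set (Fin m → ℝ) := {c | (∀ i, 0 ≤ c i) ∧ ∀ i, i ∉ S.muPart μ Set.univ → c i = 0}
  have hD : IsClosed D := by
    have : D = (⋂ i, {c | 0 ≤ c i}) ∩ ⋂ i, ⋂ (_ : i ∉ S.muPart μ Set.univ), {c | c i = 0} := by
      ext; simp [D]
    rw [this]
    refine IsClosed.inter (isClosed_iInter fun i => isClosed_le continuous_const
      (continuous_apply i)) (isClosed_iInter fun i => isClosed_iInter fun _ =>
        isClosed_eq (continuous_apply i) continuous_const)
  have hemb : Topology.IsClosedEmbedding S.lc :=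
    LinearMap.isClosedEmbedding_of_injective (LinearMap.ker_eq_bot.2 S.lc_inj)
  have hE : IsClosed ((fun v => μ - v) ⁻¹' (S.lc '' D)) :=
    (hemb.isClosedMap D hD).preimage (continuous_const.sub continuous_id)
  have heq : S.orbitHull μ ∩ S.chamber = ((fun v => μ - v) ⁻¹' (S.lc '' D)) ∩ S.chamber := by
    apply Set.Subset.antisymm
    · rintro v ⟨hv, hvC⟩
      obtain ⟨c, hc, hcP, -, h⟩ := S.hull_sub hμ hv
      exact ⟨⟨c, ⟨hc, hcP⟩, by rw [h]; simp⟩, hvC⟩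
    · rintro v ⟨⟨c, ⟨hc, hcP⟩, h⟩, hvC⟩
      refine ⟨?_, hvC⟩
      have hv : v = μ - S.lc c := by rw [h]; simp
      have hcb : ∀ i, S.coroot i (S.lc c) ≤ S.coroot i μ := by
        intro i
        have := hvC i
        rw [hv, map_sub] at this
        linarith
      rw [hv]
      refine S.mem_of_le hμ (I := {i | c i ≠ 0}) ?_ (fun i hi => by simpa using hi)
        (fun i hi => lt_of_le_of_ne (hc i) (Ne.symm hi)) (fun i _ => hcb i)
      intro R hR hne h0
      by_contra hcon
      push Not at hcon
      obtain ⟨i, hi⟩ := hne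
      have hRP : ∀ j ∈ R, j ∈ S.muPart μ Set.univ ∩ S.J0 μ := by
        intro j hj
        refine ⟨?_, h0 j hj⟩
        by_contra h
        exact hR hj (hcP j h)
      set M := S.muPart μ Set.univ ∩ S.J0 μ with hM
      set K := S.comp M i with hK
      have hKf : S.FiniteType K := hfin i (hRP i hi)
      have hp := S.fin_nonpos hKf (p := indL (R ∩ K) c)
        (fun j hj => indL_not (fun h => hj h.2) _) ?_ i
      · rw [indL_mem (show i ∈ R ∩ K from ⟨hi, S.comp_self (hRP i hi)⟩)] at hp
        exact hR hi (le_antisymm hp (hc i))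
      · intro k hk
        by_cases hkR : k ∈ R
        · have h1 : S.coroot k (S.lc (indL (R ∩ K) c)) = S.coroot k (S.lc c) := by
            rw [coroot_lc, coroot_lc]
            refine Finset.sum_congr rfl fun j _ => ?_
            by_cases hjR : j ∈ R
            · by_cases hjK : j ∈ K
              · rw [indL_mem (show j ∈ R ∩ K from ⟨hjR, hjK⟩)]
              · have : S.A k j = 0 := by
                  by_contra hA
                  exact hjK (S.comp_nbr hk (hRP j hjR) hA)
                simp [this]
            · by_cases hjI : c j = 0
              · rw [indL_not (fun h => hjR h.1), hjI]
              · rw [hcon k hkR j hjI hjR]; simp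
          rw [h1, ← h0 k hkR]
          exact hcb k
        · refine S.coroot_nonpos (fun j => ?_) (indL_not (fun h => hkR h.1) _)
          by_cases hj : j ∈ R ∩ K
          · rw [indL_mem hj]; exact hc j
          · rw [indL_not hj]
  rw [heq]
  exact hE.inter S.chamber_closed

theorem dir_finite {μ : V} (hμ : μ ∈ S.chamber) (hcl : IsClosed (S.orbitHull μ ∩ S.chamber)) :
    S.FinTypeComponents (S.muPart μ Set.univ ∩ S.J0 μ) := by
  intro i hi
  by_contra hcon
  obtain ⟨c, hc, hcne, hcK, hcl0⟩ := S.infinite_c hcon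
  have hneg : ∀ k, S.coroot k (S.lc c) ≤ 0 := by
    intro k
    by_cases hk : k ∈ S.comp (S.muPart μ Set.univ ∩ S.J0 μ) i
    · exact hcl0 k hk
    · exact S.coroot_nonpos hc (hcK k hk)
  obtain ⟨d, hdP, hd, hdμ⟩ := S.full_support hμ
  have hcP : ∀ j, j ∉ S.muPart μ Set.univ → c j = 0 := fun j hj =>
    hcK j fun h => hj (S.comp_sub h).1
  have hmem : ∀ t : ℝ, 0 < t → t < 1 →
      μ - S.lc ((1 - t) • c + t • d) ∈ S.orbitHull μ ∩ S.chamber := by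
    intro t ht0 ht1
    have hle : ∀ k, S.coroot k (S.lc ((1 - t) • c + t • d)) ≤ S.coroot k μ := by
      intro k
      simp only [map_add, map_smul, smul_eq_mul]
      have h1 := mul_nonpos_of_nonneg_of_nonpos (sub_nonneg.2 ht1.le) (hneg k)
      have h2 := mul_le_mul_of_nonneg_left (hdμ k) ht0.le
      have h3 := mul_le_mul_of_nonneg_right ht1.le (hμ k)
      linarith
    refine ⟨S.mem_of_le hμ (S.MC_P μ) (fun j hj => by simp [hcP j hj, hdP j hj])
      (fun j hj => ?_) (fun k _ => hle k), fun k => ?_⟩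
    · have h1 := mul_nonneg (sub_nonneg.2 ht1.le) (hc j)
      have h2 := mul_pos ht0 (hd j hj)
      simp only [Pi.add_apply, Pi.smul_apply, smul_eq_mul]
      linarith
    · rw [map_sub]; have := hle k; linarith
  have hlim : Filter.Tendsto (fun t : ℝ => μ - S.lc ((1 - t) • c + t • d))
      (nhdsWithin 0 (Set.Ioi 0)) (nhds (μ - S.lc c)) := by
    have h1 : Continuous (fun t : ℝ => μ - S.lc ((1 - t) • c + t • d)) :=
      continuous_const.sub (S.lc_cont.comp (by fun_prop))
    have h2 := h1.tendsto 0
    simp only [sub_zero, one_smul, zero_smul, add_zero] at h2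
    exact h2.mono_left nhdsWithin_le_nhds
  have hev : ∀ᶠ t in nhdsWithin (0 : ℝ) (Set.Ioi 0),
      μ - S.lc ((1 - t) • c + t • d) ∈ S.orbitHull μ ∩ S.chamber := by
    filter_upwards [Ioo_mem_nhdsGT (zero_lt_one (α := ℝ))] with t ht using hmem t ht.1 ht.2
  have hin := hcl.mem_of_tendsto hlim hev
  obtain ⟨e, -, -, heJ, he⟩ := S.hull_sub hμ hin.1
  have hce : c = e := by
    apply S.lc_inj
    simpa using he
  apply hcne
  rw [hce]
  apply heJ
  intro j hj
  rw [← hce]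
  exact hcK j fun h => hj (S.comp_sub h).2

end helpers5

end GCMRealization
open GCMRealization in
theorem statement_10 {m : ℕ} {V : Type*} [NormedAddCommGroup V] [NormedSpace ℝ V]
    (S : GCMRealization m V) (μ : V) (hμ : μ ∈ S.chamber) :
    IsClosed (S.orbitHull μ ∩ S.chamber) ↔
      S.FinTypeComponents (S.muPart μ Set.univ ∩ S.J0 μ) := by
  exact ⟨S.dir_finite hμ, S.dir_closed hμ⟩
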